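/- arXiv:2301.10131 — 2 statements merged into one kernel-verified Lean document; each statement's English description precedes it below -/
import Mathlib

section
/- For every δ > 0 there exists τ > 0 such that for every ν > 0 and every ε > 0 there exists n₀ ∈ ℕ such that the following holds for every even n ≥ n₀ and every integer d ≥ δn: if G is a d-regular robust (ν,τ)-expander on n vertices, then G has at least one perfect matching, and for a uniformly random perfect matching M of G and any edge e ∈ E(G), one has (1−ε)/d ≤ P[e ∈ M] ≤ (1+ε)/d. -/
open Finset

namespace RPM

/-- The `ν`-robust neighbourhood of a vertex set `S` in a graph `G` on `n` vertices:
all vertices having at least `ν * n` neighbours in `S`. -/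
def RN {V : Type*} [Fintype V] (G : SimpleGraph V) (ν : ℝ) (S : Set V) : Set V :=
  {v : V | ν * (Fintype.card V : ℝ) ≤ (Nat.card {u : V | u ∈ S ∧ G.Adj v u} : ℝ)}

/-- `G` is a robust `(ν, τ)`-expander. -/
def RobustExpander {V : Type*} [Fintype V] (G : SimpleGraph V) (ν τ : ℝ) : Prop :=
  ∀ S : Set V,
    τ * (Fintype.card V : ℝ) ≤ (Nat.card S : ℝ) →
    (Nat.card S : ℝ) ≤ (1 - τ) * (Fintype.card V : ℝ) →
    (Nat.card S : ℝ) + ν * (Fintype.card V : ℝ) ≤ (Nat.card (RN G ν S) : ℝ)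

/-- `M` (a set of edges) is a perfect matching of `G`: its edges are edges of `G`,
and every vertex lies in exactly one edge of `M` (in particular the edges are
pairwise disjoint and cover all vertices). -/
def IsPM {V : Type*} (G : SimpleGraph V) (M : Finset (Sym2 V)) : Prop :=
  (∀ e ∈ M, e ∈ G.edgeSet) ∧ ∀ v : V, ∃! e, e ∈ M ∧ v ∈ e

/-- The number of perfect matchings of `G`. -/
noncomputable def pmCount {V : Type*} (G : SimpleGraph V) : ℕ :=
  Nat.card {M : Finset (Sym2 V) // IsPM G M}

/-- `N` (a set of edges) is a matching in `G`: edges of `G`, pairwise disjoint. -/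
def IsMatchingIn {V : Type*} (G : SimpleGraph V) (N : Finset (Sym2 V)) : Prop :=
  (∀ e ∈ N, e ∈ G.edgeSet) ∧ ∀ e ∈ N, ∀ f ∈ N, e ≠ f → ∀ v : V, v ∈ e → v ∉ f

/-- `G` is `d`-regular: every vertex has exactly `d` neighbours. -/
def RegularDeg {V : Type*} (G : SimpleGraph V) (d : ℕ) : Prop :=
  ∀ v : V, Nat.card {u : V | G.Adj v u} = d

/-- Probability that a uniformly random perfect matching of `G` contains the edge `e`. -/
noncomputable def edgeProb {V : Type*} (G : SimpleGraph V) (e : Sym2 V) : ℝ :=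
  (Nat.card {M : Finset (Sym2 V) // IsPM G M ∧ e ∈ M} : ℝ) / (pmCount G : ℝ)

/-- `P[X = k]` where `X = |M ∩ N|` for a uniformly random perfect matching `M` of `G`. -/
noncomputable def interProb {V : Type*} [DecidableEq V] (G : SimpleGraph V)
    (N : Finset (Sym2 V)) (k : ℕ) : ℝ :=
  (Nat.card {M : Finset (Sym2 V) // IsPM G M ∧ (M ∩ N).card = k} : ℝ) / (pmCount G : ℝ)

/-- The Poisson probability mass function with parameter `lam`. -/
noncomputable def poissonPMF (lam : ℝ) (k : ℕ) : ℝ :=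
  Real.exp (-lam) * lam ^ k / (Nat.factorial k)

section Mixing

open scoped Classical Matrix

variable {V : Type}

/-- The matrix whose `(a, c)` entry indicates whether one can go from `a` to `c` by following an
edge of `G` and then applying `σ`. -/
noncomputable def mateMatrix (G : SimpleGraph V) (σ : V → V) : Matrix V V ℝ :=
  Matrix.of fun a c => if G.Adj a (σ c) then 1 else 0

lemma mateMatrix_apply (G : SimpleGraph V) (σ : V → V) (a c : V) :
    mateMatrix G σ a c = if G.Adj a (σ c) then 1 else 0 := rfl

/-- The sequence `v` traces a cycle alternating between pairs of `σ` and edges of `G`: the vertices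
`v i` and `σ (v i)` are all distinct and `v i` is adjacent to `σ (v (i + 1))`, cyclically. -/
def AltCycle (G : SimpleGraph V) (σ : V → V) {m : ℕ} (v : Fin (m + 1) → V) : Prop :=
  (∀ i, G.Adj (v i) (σ (v (i + 1)))) ∧ Function.Injective (Sum.elim v (σ ∘ v))

lemma forall_adj_succ_iff (G : SimpleGraph V) (σ : V → V) {m : ℕ} (v : Fin (m + 1) → V) :
    (∀ i, G.Adj (v i) (σ (v (i + 1)))) ↔
      (∀ i : Fin m, G.Adj (v i.castSucc) (σ (v i.succ))) ∧ G.Adj (v (Fin.last m)) (σ (v 0)) := by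
  rw [Fin.forall_fin_succ']
  simp

lemma mateMatrix_nonneg (G : SimpleGraph V) (σ : V → V) (a c : V) :
    0 ≤ mateMatrix G σ a c := by
  rw [mateMatrix_apply]; split_ifs <;> norm_num

variable [Fintype V]

lemma RegularDeg.card_filter {G : SimpleGraph V} {d : ℕ} (hG : RegularDeg G d) (a : V) :
    #{u | G.Adj a u} = d := by
  rw [← hG a, Nat.card_eq_fintype_card, Fintype.card_ofFinset]
  rfl

lemma card_filter_comp {σ : V → V} (hσ : Function.Involutive σ) (p : V → Prop) :
    #{c | p (σ c)} = #{c | p c} := by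
  refine Finset.card_bij (fun c _ => σ c) ?_ (fun _ _ _ _ h => hσ.injective h) ?_
  · simp
  · intro b hb
    exact ⟨σ b, by simpa [hσ b] using hb, hσ b⟩

lemma mateMatrix_mulVec_one {G : SimpleGraph V} {d : ℕ} (hG : RegularDeg G d) {σ : V → V}
    (hσ : Function.Involutive σ) : mateMatrix G σ *ᵥ 1 = (d : ℝ) • 1 := by
  ext a
  have := card_filter_comp hσ (fun u => G.Adj a u)
  rw [hG.card_filter] at this
  simp [Matrix.mulVec, dotProduct, mateMatrix_apply, this]

lemma one_vecMul_mateMatrix {G : SimpleGraph V} {d : ℕ} (hG : RegularDeg G d) (σ : V → V) :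
    1 ᵥ* mateMatrix G σ = (d : ℝ) • 1 := by
  ext a
  have := hG.card_filter (σ a)
  simp only [G.adj_comm (σ a)] at this
  simp [Matrix.vecMul, dotProduct, mateMatrix_apply, this]

lemma pow_mulVec_one {B : Matrix V V ℝ} {d : ℝ} (hB : B *ᵥ 1 = d • 1) (k : ℕ) :
    B ^ k *ᵥ 1 = d ^ k • 1 := by
  induction k with
  | zero => simp
  | succ k ih => rw [pow_succ, ← Matrix.mulVec_mulVec, hB, Matrix.mulVec_smul, ih, smul_smul,
      pow_succ, mul_comm]

lemma sum_pow_mulVec {B : Matrix V V ℝ} {d : ℝ} (hB : 1 ᵥ* B = d • 1) (h : V → ℝ) (k : ℕ) :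
    ∑ a, (B ^ k *ᵥ h) a = d ^ k * ∑ a, h a := by
  have key : ∀ h : V → ℝ, ∑ a, (B *ᵥ h) a = d * ∑ a, h a := fun h => by
    have := Matrix.dotProduct_mulVec 1 B h
    rw [hB, smul_dotProduct] at this
    simpa [one_dotProduct] using this
  induction k with
  | zero => simp
  | succ k ih => rw [pow_succ', ← Matrix.mulVec_mulVec, key, ih, pow_succ]; ring

/-- Doeblin-type contraction of mean-zero functions. -/
lemma abs_mulVec_le {B : Matrix V V ℝ} {R γ r : ℝ} (hR : B *ᵥ 1 = R • 1)
    (hγ : ∀ a b, γ ≤ B a b) {h : V → ℝ} (h0 : ∑ a, h a = 0) (hr : ∀ a, |h a| ≤ r) (a : V) :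
    |(B *ᵥ h) a| ≤ (R - γ * Fintype.card V) * r := by
  have h1 : (B *ᵥ h) a = ∑ b, (B a b - γ) * h b := by
    simp [Matrix.mulVec, dotProduct, sub_mul, Finset.sum_sub_distrib, ← Finset.mul_sum, h0]
  have h2 : ∑ b, B a b = R := by
    simpa [Matrix.mulVec, dotProduct] using congrFun hR a
  have h3 : (R - γ * Fintype.card V) * r = ∑ b, (B a b - γ) * r := by
    rw [← Finset.sum_mul, Finset.sum_sub_distrib, h2]
    simp [mul_comm]
  rw [h1, h3]
  refine (Finset.abs_sum_le_sum_abs _ _).trans (Finset.sum_le_sum fun b _ => ?_)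
  rw [abs_mul, abs_of_nonneg (sub_nonneg.2 (hγ a b))]
  exact mul_le_mul_of_nonneg_left (hr b) (sub_nonneg.2 (hγ a b))

lemma abs_pow_mulVec_le {B : Matrix V V ℝ} {d c r : ℝ} {K : ℕ} (hB : B *ᵥ 1 = d • 1)
    (hB' : 1 ᵥ* B = d • 1) {γ : ℝ} (hγ : ∀ a b, γ ≤ (B ^ K) a b)
    (hc : c * d ^ K ≤ γ * Fintype.card V) {h : V → ℝ} (h0 : ∑ a, h a = 0)
    (hr : ∀ a, |h a| ≤ r) (j : ℕ) (a : V) :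
    |(B ^ (K * j) *ᵥ h) a| ≤ (1 - c) ^ j * d ^ (K * j) * r := by
  induction j generalizing a with
  | zero => simpa using hr a
  | succ j ih =>
    rw [mul_add, mul_one, add_comm, pow_add, ← Matrix.mulVec_mulVec]
    refine (abs_mulVec_le (pow_mulVec_one hB K) hγ (by rw [sum_pow_mulVec hB', h0, mul_zero])
      ih a).trans ?_
    have : 0 ≤ (1 - c) ^ j * d ^ (K * j) * r := (abs_nonneg _).trans (ih a)
    calc _ ≤ (d ^ K - c * d ^ K) * ((1 - c) ^ j * d ^ (K * j) * r) := by gcongr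
      _ = _ := by ring

lemma mateMatrix_pow_lower {G : SimpleGraph V} {d : ℕ} (hG : RegularDeg G d) {δ ν η : ℝ}
    (hδ1 : δ ≤ 1) (hν : 0 < ν) (hd : δ * Fintype.card V ≤ d) (hexp : RobustExpander G ν (δ / 2))
    (h_η : 0 ≤ η) (hην : η ≤ ν) (hηδ : η ≤ δ / 2)
    {σ : V → V} (hσ : Function.Involutive σ) (b : V) (k : ℕ) :
    ∃ S : Finset V, (∀ a ∈ S, (η * Fintype.card V) ^ k ≤ (mateMatrix G σ ^ (k + 1)) a b) ∧
      min (Fintype.card V : ℝ) (δ / 2 * Fintype.card V + k * ν * Fintype.card V) ≤ #S := by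
  set n : ℝ := (Fintype.card V : ℝ) with hn
  have hn0 : 0 ≤ n := Nat.cast_nonneg _
  induction k with
  | zero =>
    refine ⟨Finset.univ.filter fun a => G.Adj a (σ b), fun a ha => ?_, ?_⟩
    · simp only [Finset.mem_filter_univ] at ha
      simp [mateMatrix_apply, ha]
    · have := hG.card_filter (σ b)
      simp only [G.adj_comm (σ b)] at this
      rw [this]
      refine (min_le_right _ _).trans ?_
      push_cast
      nlinarith
  | succ k ih =>
    obtain ⟨S, hS, hcard⟩ := ih
    have step : ∀ a, η * n ≤ #{c ∈ S | G.Adj a (σ c)} →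
        (η * n) ^ (k + 1) ≤ (mateMatrix G σ ^ (k + 1 + 1)) a b := by
      intro a ha
      have hnn : ∀ c, 0 ≤ (mateMatrix G σ ^ (k + 1)) c b := by
        have : ∀ j a c, 0 ≤ (mateMatrix G σ ^ j) a c := by
          intro j
          induction j with
          | zero => intro a c; rw [pow_zero, Matrix.one_apply]; split_ifs <;> norm_num
          | succ j ih =>
            intro a c
            rw [pow_succ, Matrix.mul_apply]
            exact Finset.sum_nonneg fun i _ => mul_nonneg (ih _ _) (mateMatrix_nonneg _ _ _ _)
        exact fun c => this _ _ _
      rw [pow_succ' (mateMatrix G σ), Matrix.mul_apply]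
      calc (η * n) ^ (k + 1) = (η * n) * (η * n) ^ k := pow_succ' _ _
        _ ≤ #{c ∈ S | G.Adj a (σ c)} * (η * n) ^ k := by gcongr
        _ = ∑ c ∈ S with G.Adj a (σ c), (η * n) ^ k := by simp
        _ ≤ ∑ c ∈ S with G.Adj a (σ c), mateMatrix G σ a c * (mateMatrix G σ ^ (k + 1)) c b := by
          refine Finset.sum_le_sum fun c hc => ?_
          rw [Finset.mem_filter] at hc
          simpa [mateMatrix_apply, hc.2] using hS c hc.1
        _ ≤ _ := Finset.sum_le_sum_of_subset_of_nonneg (Finset.subset_univ _)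
          fun c _ _ => mul_nonneg (mateMatrix_nonneg _ _ _ _) (hnn c)
    have hlow : δ / 2 * n ≤ #S := by
      refine le_trans (le_min ?_ ?_) hcard
      · nlinarith
      · have : 0 ≤ k * ν * n := by positivity
        linarith
    by_cases hbig : (#S : ℝ) ≤ (1 - δ / 2) * n
    · set S' : Set V := ↑(S.image σ) with hS'
      have hS'card : Nat.card S' = #S := by
        rw [hS', Nat.card_coe_set_eq, Set.ncard_coe_finset,
          Finset.card_image_of_injective _ hσ.injective]
      have hR := hexp S' (by rwa [hS'card]) (by rwa [hS'card])
      refine ⟨(RN G ν S').toFinset, fun a ha => step a ?_, ?_⟩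
      · rw [Set.mem_toFinset] at ha
        have ha' : ν * n ≤ (Nat.card {u : V | u ∈ S' ∧ G.Adj a u} : ℝ) := ha
        have hcc : Nat.card {u : V | u ∈ S' ∧ G.Adj a u} = #{c ∈ S | G.Adj a (σ c)} := by
          have : {u : V | u ∈ S' ∧ G.Adj a u}
              = ↑(({c ∈ S | G.Adj a (σ c)} : Finset V).image σ) := by
            ext u
            simp only [hS', Finset.coe_image, Set.mem_image, Finset.mem_coe, Set.mem_ofPred_eq,
              Finset.mem_filter]
            constructor
            · rintro ⟨⟨c, hc, rfl⟩, h⟩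
              exact ⟨c, ⟨hc, h⟩, rfl⟩
            · rintro ⟨c, ⟨hc, h⟩, rfl⟩
              exact ⟨⟨c, hc, rfl⟩, h⟩
          rw [this, Nat.card_coe_set_eq, Set.ncard_coe_finset,
            Finset.card_image_of_injective _ hσ.injective]
        rw [hcc] at ha'
        exact le_trans (by gcongr) ha'
      · have hc2 : Nat.card (RN G ν S') = #(RN G ν S').toFinset := by
          rw [Nat.card_eq_fintype_card, Set.toFinset_card]
        rw [hc2, hS'card] at hR
        refine le_trans ?_ hR
        have hνn : 0 ≤ ν * n := by positivity
        rcases min_le_iff.1 hcard with h | h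
        · exact (min_le_left _ _).trans (by linarith)
        · refine (min_le_right _ _).trans ?_
          push_cast
          linarith
    · refine ⟨Finset.univ, fun a _ => step a ?_, by simp [hn]⟩
      have h1 : #{c | G.Adj a (σ c)} = d :=
        (card_filter_comp hσ (fun u => G.Adj a u)).trans (hG.card_filter a)
      have h2 : #{c | G.Adj a (σ c)} ≤ #{c ∈ S | G.Adj a (σ c)} + #Sᶜ := by
        refine le_trans (Finset.card_le_card ?_) (Finset.card_union_le _ _)
        intro c hc
        simp only [Finset.mem_filter_univ] at hc
        by_cases h : c ∈ S <;> simp [h, hc]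
      have h3 : (#S : ℝ) + #Sᶜ = n := by
        rw [hn]; exact_mod_cast Finset.card_add_card_compl S
      rw [h1] at h2
      have h2' : (d : ℝ) ≤ #{c ∈ S | G.Adj a (σ c)} + #Sᶜ := by exact_mod_cast h2
      have : η * n ≤ δ / 2 * n := by gcongr
      push Not at hbig
      linarith
lemma RegularDeg.le_card {G : SimpleGraph V} {d : ℕ} (hG : RegularDeg G d) [Nonempty V] :
    d ≤ Fintype.card V := by
  rw [← hG.card_filter (Classical.arbitrary V)]
  exact Finset.card_le_univ _

lemma exists_mixing {δ ν ε : ℝ} (hδ : 0 < δ) (hν : 0 < ν) (hε : 0 < ε) :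
    ∃ m : ℕ, 1 ≤ m ∧ ∀ (V : Type) [Fintype V] [Nonempty V] (G : SimpleGraph V) (d : ℕ),
      RegularDeg G d → δ * Fintype.card V ≤ d → RobustExpander G ν (δ / 2) →
      ∀ σ : V → V, Function.Involutive σ → ∀ Q : V → Prop, #{c | Q c} = d → ∀ a : V,
        |(mateMatrix G σ ^ m *ᵥ fun c => if Q c then 1 else 0) a
          - (d : ℝ) ^ (m + 1) / Fintype.card V| ≤ ε * ((d : ℝ) ^ (m + 1) / Fintype.card V) ∧
        |(mateMatrix G σ ^ (m + 1) *ᵥ fun c => if Q c then 1 else 0) a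
          - (d : ℝ) ^ (m + 2) / Fintype.card V| ≤ ε * ((d : ℝ) ^ (m + 2) / Fintype.card V) := by
  set k := ⌈1 / ν⌉₊ with hk
  set η : ℝ := min ν (min (δ / 2) 1) with h_η
  have hη0 : 0 < η := by positivity
  have hη1 : η ≤ 1 := (min_le_right _ _).trans (min_le_right _ _)
  have hηδ : η ≤ δ / 2 := (min_le_right _ _).trans (min_le_left _ _)
  have hc0 : 0 < η ^ k := by positivity
  have hc1 : η ^ k ≤ 1 := pow_le_one₀ hη0.le hη1
  obtain ⟨j, hj⟩ := exists_pow_lt_of_lt_one (show 0 < ε * δ by positivity)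
    (show 1 - η ^ k < 1 by linarith)
  refine ⟨(k + 1) * (j + 1), Nat.succ_le_of_lt (by positivity),
    fun V _ _ G d hG hd hexp σ hσ Q hQ a => ?_⟩
  set m := (k + 1) * (j + 1) with hm
  set n : ℝ := (Fintype.card V : ℝ) with hn
  have hn0 : 0 < n := by rw [hn]; exact_mod_cast Fintype.card_pos
  have hdn : (d : ℝ) ≤ n := by rw [hn]; exact_mod_cast hG.le_card
  have hδ1 : δ ≤ 1 := by
    by_contra! h
    nlinarith
  set B := mateMatrix G σ with hB
  have hB1 : B *ᵥ 1 = (d : ℝ) • 1 := mateMatrix_mulVec_one hG hσ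
  have hB2 : 1 ᵥ* B = (d : ℝ) • 1 := one_vecMul_mateMatrix hG σ
  have hγ : ∀ a b, (η * n) ^ k ≤ (B ^ (k + 1)) a b := by
    intro a b
    obtain ⟨S, hS, hcard⟩ := mateMatrix_pow_lower hG hδ1 hν hd hexp hη0.le (min_le_left _ _)
      hηδ hσ b k
    have hkν : 1 ≤ k * ν := by
      have := Nat.le_ceil (1 / ν)
      rwa [div_le_iff₀ hν] at this
    rw [min_eq_left] at hcard
    · have : S = Finset.univ := by
        rw [← Finset.card_eq_iff_eq_univ]
        exact le_antisymm (Finset.card_le_univ _) (by exact_mod_cast hcard)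
      exact hS a (by simp [this])
    · have : 0 ≤ δ / 2 * n := by positivity
      have : n ≤ k * ν * n := le_mul_of_one_le_left hn0.le hkν
      linarith
  set h : V → ℝ := (fun c => if Q c then 1 else 0) - (d / n) • 1 with hh
  have hg : (fun c => if Q c then (1 : ℝ) else 0) = (d / n) • 1 + h := by simp [hh]
  have h0 : ∑ a, h a = 0 := by
    simp only [hh, Pi.sub_apply, Pi.smul_apply, Pi.one_apply, Finset.sum_sub_distrib,
      Finset.sum_boole, hQ, Finset.sum_const, Finset.card_univ, smul_eq_mul, nsmul_eq_mul, ← hn]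
    field_simp
    simp
  have hr : ∀ a, |h a| ≤ 1 := by
    intro a
    have h1 : d / n ≤ 1 := (div_le_one hn0).2 hdn
    have h2 : 0 ≤ d / n := by positivity
    simp only [hh, Pi.sub_apply, Pi.smul_apply, Pi.one_apply, smul_eq_mul, mul_one]
    rw [abs_le]
    split_ifs <;> constructor <;> linarith
  have hd0 : (0 : ℝ) ≤ d := Nat.cast_nonneg _
  have hmain : ∀ a, |(B ^ m *ᵥ h) a| ≤ ε * (d ^ (m + 1) / n) := by
    intro a
    refine (abs_pow_mulVec_le (c := η ^ k) hB1 hB2 hγ ?_ h0 hr (j + 1) a).trans ?_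
    · rw [mul_pow, pow_succ, mul_assoc, ← hn]
      gcongr
    · rw [mul_one, ← hm]
      have hj' : (1 - η ^ k) ^ (j + 1) ≤ ε * δ :=
        (pow_le_pow_of_le_one (by linarith) (by linarith) (Nat.le_succ j)).trans hj.le
      calc (1 - η ^ k) ^ (j + 1) * (d : ℝ) ^ m ≤ ε * δ * d ^ m := by gcongr
        _ ≤ ε * (d / n) * d ^ m := by
          gcongr
          rwa [le_div_iff₀ hn0]
        _ = _ := by ring
  have hexpand : ∀ l a, (B ^ l *ᵥ fun c => if Q c then 1 else 0) a - (d : ℝ) ^ (l + 1) / n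
      = (B ^ l *ᵥ h) a := by
    intro l a
    rw [hg, Matrix.mulVec_add, Matrix.mulVec_smul, pow_mulVec_one hB1]
    simp
    ring
  rw [hexpand, hexpand]
  refine ⟨hmain a, ?_⟩
  rw [pow_succ', ← Matrix.mulVec_mulVec]
  refine (abs_mulVec_le (γ := 0) hB1 (mateMatrix_nonneg G σ)
    (by rw [sum_pow_mulVec hB2, h0, mul_zero]) hmain a).trans (le_of_eq ?_)
  ring

/-- Matrix powers count alternating walks. -/
lemma card_walks (G : SimpleGraph V) (σ : V → V) (Q : V → Prop) (m : ℕ) (a : V) :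
    (#{v : Fin (m + 1) → V | v 0 = a ∧ (∀ i : Fin m, G.Adj (v i.castSucc) (σ (v i.succ))) ∧
      Q (v (Fin.last m))} : ℝ) = (mateMatrix G σ ^ m *ᵥ fun c => if Q c then 1 else 0) a := by
  induction m generalizing a with
  | zero =>
    rw [← Finset.sum_boole, ← (Equiv.funUnique (Fin 1) V).symm.sum_comp]
    simp only [pow_zero, Matrix.one_mulVec]
    rw [Finset.sum_eq_single a]
    · simp [Equiv.funUnique]
    · intro b _ hb
      simp [Equiv.funUnique, hb]
    · simp
  | succ m ih =>
    rw [pow_succ', ← Matrix.mulVec_mulVec]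
    simp only [Matrix.mulVec, dotProduct] at ih ⊢
    simp only [← ih]
    rw [← Finset.sum_boole, ← (Fin.consEquiv fun _ => V).sum_comp, Fintype.sum_prod_type,
      Finset.sum_eq_single a]
    · simp only [← Finset.sum_boole, Finset.mul_sum]
      rw [Finset.sum_comm]
      refine Finset.sum_congr rfl fun w _ => ?_
      rw [Finset.sum_eq_single (w 0)]
      · simp only [mateMatrix_apply, Fin.consEquiv_apply, Fin.forall_fin_succ]
        simp only [Fin.cons_zero, Fin.cons_succ, Fin.castSucc_zero, Fin.castSucc_succ,
          ← Fin.succ_last, mul_ite, mul_one, mul_zero, ← ite_and]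
        exact if_congr (by simp; tauto) rfl rfl
      · intro c _ hc
        simp [hc.symm]
      · simp
    · intro b _ hb
      simp [hb]
    · simp

lemma card_coincidence_le {I : Type} [Fintype I] (F : Finset I) (g : I → V) {i j : I}
    (hij : i ≠ j) (hi : i ∉ F) (π : V → V) :
    #{v : I → V | (∀ k ∈ F, v k = g k) ∧ v i = π (v j)}
      ≤ Fintype.card V ^ (Fintype.card I - (#F + 1)) := by
  have h : Fintype.card ({k // k ∉ insert i F} → V)
      = Fintype.card V ^ (Fintype.card I - (#F + 1)) := by
    rw [Fintype.card_fun, Fintype.card_subtype_compl, Fintype.card_coe,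
      Finset.card_insert_of_notMem hi]
  rw [← h, ← Finset.card_univ]
  refine Finset.card_le_card_of_injOn (fun v k => v k) (fun _ _ => Finset.mem_coe.2
    (Finset.mem_univ _)) ?_
  intro v hv w hw hvw
  simp only [Finset.coe_filter, Finset.mem_univ, true_and, Set.mem_ofPred_eq] at hv hw
  have key : ∀ k, k ≠ i → v k = w k := by
    intro k hk
    by_cases hF : k ∈ F
    · rw [hv.1 k hF, hw.1 k hF]
    · exact congrFun hvw ⟨k, by simp [hk, hF]⟩
  funext k
  by_cases hk : k = i
  · rw [hk, hv.2, hw.2, key j hij.symm]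
  · exact key k hk

lemma card_coincidences_le {I : Type} [Fintype I] (F : Finset I) (g : I → V) {σ : V → V}
    (hσ : Function.Involutive σ)
    (hg : ∀ i ∈ F, ∀ j ∈ F, i ≠ j → g i ≠ g j ∧ g i ≠ σ (g j)) :
    #{v : I → V | (∀ k ∈ F, v k = g k) ∧ ∃ i j, i ≠ j ∧ (v i = v j ∨ v i = σ (v j))}
      ≤ Fintype.card I ^ 2 * (2 * Fintype.card V ^ (Fintype.card I - (#F + 1))) := by
  let A : I × I → Finset (I → V) := fun p => if p.1 ≠ p.2 ∧ p.1 ∉ F then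
    ({v : I → V | (∀ k ∈ F, v k = g k) ∧ v p.1 = id (v p.2)} : Finset (I → V)) ∪
      ({v : I → V | (∀ k ∈ F, v k = g k) ∧ v p.1 = σ (v p.2)} : Finset (I → V)) else ∅
  have hA : ∀ p ∈ (Finset.univ : Finset (I × I)),
      #(A p) ≤ 2 * Fintype.card V ^ (Fintype.card I - (#F + 1)) := by
    intro p _
    simp only [A]
    split_ifs with h
    · refine (Finset.card_union_le _ _).trans ?_
      rw [two_mul]
      exact add_le_add (card_coincidence_le F g h.1 h.2 id) (card_coincidence_le F g h.1 h.2 σ)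
    · simp
  have := Finset.card_biUnion_le_card_mul _ A _ hA
  rw [Finset.card_univ, Fintype.card_prod, ← sq] at this
  refine (Finset.card_le_card ?_).trans this
  intro v hv
  simp only [Finset.mem_filter_univ] at hv
  obtain ⟨hF, i, j, hij, h⟩ := hv
  simp only [Finset.mem_biUnion, Finset.mem_univ, true_and, A]
  by_cases hi : i ∈ F
  · by_cases hj : j ∈ F
    · have := hg i hi j hj hij
      rw [hF i hi, hF j hj] at h
      tauto
    · refine ⟨(j, i), ?_⟩
      have h' : v j = v i ∨ v j = σ (v i) := by
        rcases h with h | h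
        · exact Or.inl h.symm
        · exact Or.inr (by rw [h, hσ])
      simp only [ne_eq, hij.symm, hj, not_false_eq_true, and_self, if_true, Finset.mem_union,
        Finset.mem_filter_univ, id]
      tauto
  · refine ⟨(i, j), ?_⟩
    simp only [ne_eq, hij, hi, not_false_eq_true, and_self, if_true, Finset.mem_union,
      Finset.mem_filter_univ, id]
    tauto

lemma abs_sub_le_of_le_of_le_add {x y z : ℕ} {N ε : ℝ} (h1 : x ≤ y) (h2 : y ≤ x + z)
    (hy : |(y : ℝ) - N| ≤ ε / 2 * N) (hz : (z : ℝ) ≤ ε / 2 * N) : |(x : ℝ) - N| ≤ ε * N := by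
  have h1' : (x : ℝ) ≤ y := by exact_mod_cast h1
  have h2' : (y : ℝ) ≤ x + z := by exact_mod_cast h2
  rw [abs_le] at hy ⊢
  constructor <;> linarith

/-- Almost all closed walks, subject to prescribed values on `F`, are cycles. -/
lemma abs_card_altCycle_sub_le (G : SimpleGraph V) {m : ℕ} (F : Finset (Fin (m + 1)))
    (g : Fin (m + 1) → V) {σ : V → V} (hσ : Function.Involutive σ) (hσ' : ∀ v, σ v ≠ v)
    (hg : ∀ i ∈ F, ∀ j ∈ F, i ≠ j → g i ≠ g j ∧ g i ≠ σ (g j)) {N ε : ℝ}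
    (hN : |(#{v : Fin (m + 1) → V | (∀ k ∈ F, v k = g k) ∧
      ∀ i, G.Adj (v i) (σ (v (i + 1)))} : ℝ) - N| ≤ ε / 2 * N)
    (hbad : ((m + 1) ^ 2 * 2 : ℝ) * Fintype.card V ^ (m + 1 - (#F + 1)) ≤ ε / 2 * N) :
    |(#{v : Fin (m + 1) → V | (∀ k ∈ F, v k = g k) ∧ AltCycle G σ v} : ℝ) - N| ≤ ε * N := by
  have h1 : #{v : Fin (m + 1) → V | (∀ k ∈ F, v k = g k) ∧ AltCycle G σ v}
      ≤ #{v : Fin (m + 1) → V | (∀ k ∈ F, v k = g k) ∧ ∀ i, G.Adj (v i) (σ (v (i + 1)))} :=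
    Finset.card_le_card (Finset.monotone_filter_right _ fun v _ hv => ⟨hv.1, hv.2.1⟩)
  have h2 : #{v : Fin (m + 1) → V | (∀ k ∈ F, v k = g k) ∧ ∀ i, G.Adj (v i) (σ (v (i + 1)))}
      ≤ #{v : Fin (m + 1) → V | (∀ k ∈ F, v k = g k) ∧ AltCycle G σ v} +
        #{v : Fin (m + 1) → V | (∀ k ∈ F, v k = g k) ∧
          ∃ i j, i ≠ j ∧ (v i = v j ∨ v i = σ (v j))} := by
    refine le_trans (Finset.card_le_card ?_) (Finset.card_union_le _ _)
    intro v hv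
    simp only [Finset.mem_union, Finset.mem_filter_univ] at hv ⊢
    by_cases h : ∃ i j, i ≠ j ∧ (v i = v j ∨ v i = σ (v j))
    · exact Or.inr ⟨hv.1, h⟩
    · push Not at h
      have hinj : Function.Injective v := fun i j hij => by
        by_contra hne
        exact (h i j hne).1 hij
      refine Or.inl ⟨hv.1, hv.2, hinj.sumElim (hσ.injective.comp hinj) fun i j hij => ?_⟩
      by_cases hne : i = j
      · exact hσ' (v j) (by rw [← hne] at hij ⊢; exact hij.symm)
      · exact (h i j hne).2 hij
  have h3 : #{v : Fin (m + 1) → V | (∀ k ∈ F, v k = g k) ∧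
      ∃ i j, i ≠ j ∧ (v i = v j ∨ v i = σ (v j))}
      ≤ (m + 1) ^ 2 * 2 * Fintype.card V ^ (m + 1 - (#F + 1)) := by
    have h := card_coincidences_le F g hσ hg
    rw [Fintype.card_fin, ← mul_assoc] at h
    convert h
  refine abs_sub_le_of_le_of_le_add h1 (h2.trans (Nat.add_le_add_left h3 _)) hN ?_
  rw [Nat.cast_mul, Nat.cast_pow]
  convert hbad
  push_cast
  rfl

lemma exists_card_altCycle_estimate {δ ν ε : ℝ} (hδ : 0 < δ) (hν : 0 < ν) (hε : 0 < ε) :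
    ∃ q n₀ : ℕ, ∀ (V : Type) [Fintype V] [Nonempty V] (G : SimpleGraph V) (d : ℕ),
      n₀ ≤ Fintype.card V → RegularDeg G d → δ * Fintype.card V ≤ d →
      RobustExpander G ν (δ / 2) → ∀ σ : V → V, Function.Involutive σ → (∀ v, σ v ≠ v) →
      (∀ a, |(#{v : Fin (q + 3) → V | v 0 = a ∧ AltCycle G σ v} : ℝ)
        - (d : ℝ) ^ (q + 3) / Fintype.card V| ≤ ε * ((d : ℝ) ^ (q + 3) / Fintype.card V)) ∧
      (∀ a b, a ≠ b → a ≠ σ b → G.Adj b (σ a) →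
        |(#{v : Fin (q + 3) → V | (v 0 = a ∧ v (Fin.last _) = b) ∧ AltCycle G σ v} : ℝ)
        - (d : ℝ) ^ (q + 2) / Fintype.card V| ≤ ε * ((d : ℝ) ^ (q + 2) / Fintype.card V)) := by
  obtain ⟨m, hm, hmix⟩ := exists_mixing hδ hν (half_pos hε)
  obtain ⟨q, rfl⟩ : ∃ q, m = q + 1 := ⟨m - 1, by omega⟩
  set C : ℝ := ((q + 2 : ℕ) + 1) ^ 2 * 2 with hC
  obtain ⟨n₁, hn₁⟩ := exists_nat_ge (C / (ε / 2 * δ ^ (q + 3)))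
  obtain ⟨n₂, hn₂⟩ := exists_nat_ge (C / (ε / 2 * δ ^ (q + 2)))
  refine ⟨q, max n₁ n₂, fun V _ _ G d hn hG hd hexp σ hσ hσ' => ?_⟩
  set n : ℝ := (Fintype.card V : ℝ) with hn'
  have hn0 : 0 < n := by rw [hn']; exact_mod_cast Fintype.card_pos
  have key : ∀ r : ℕ, C / (ε / 2 * δ ^ (r + 2)) ≤ n → C * n ^ r ≤ ε / 2 * (d ^ (r + 2) / n) := by
    intro r hr
    rw [div_le_iff₀ (by positivity)] at hr
    rw [← mul_div_assoc, le_div_iff₀ hn0]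
    calc C * n ^ r * n ≤ n * (ε / 2 * δ ^ (r + 2)) * n ^ r * n := by gcongr
      _ = ε / 2 * (δ * n) ^ (r + 2) := by ring
      _ ≤ _ := by gcongr
  have hnn₁ : (n₁ : ℝ) ≤ n := by rw [hn']; exact_mod_cast (le_max_left _ _).trans hn
  have hnn₂ : (n₂ : ℝ) ≤ n := by rw [hn']; exact_mod_cast (le_max_right _ _).trans hn
  have hdeg : ∀ b, #{c | G.Adj c b} = d := fun b => by
    simpa only [G.adj_comm b] using hG.card_filter b
  constructor
  · intro a
    have := abs_card_altCycle_sub_le G (m := q + 2) {0} (fun _ => a) hσ hσ'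
      (N := (d : ℝ) ^ (q + 3) / n) (ε := ε) (by simp) ?_ ?_
    · simpa using this
    · have h := (hmix V G d hG hd hexp σ hσ (fun c => G.Adj c (σ a)) (hdeg _) a).2
      rw [← card_walks] at h
      convert h using 5
      ext v
      simp only [Finset.mem_filter_univ, forall_adj_succ_iff, Finset.mem_singleton, forall_eq]
      constructor
      · rintro ⟨h1, h2, h3⟩
        exact ⟨h1, h2, h1 ▸ h3⟩
      · rintro ⟨h1, h2, h3⟩
        exact ⟨h1, h2, h1 ▸ h3⟩
    · rw [Finset.card_singleton]
      exact key (q + 1) (hn₁.trans hnn₁)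
  · intro a b hab hab' hadj
    have h0 : (0 : Fin (q + 3)) ≠ Fin.last (q + 2) := by simp [Fin.ext_iff]
    have := abs_card_altCycle_sub_le G (m := q + 2) {0, Fin.last _}
      (fun i => if i = 0 then a else b) hσ hσ'
      (N := (d : ℝ) ^ (q + 2) / n) (ε := ε) ?_ ?_ ?_
    · simpa [h0.symm] using this
    · have hba : b ≠ σ a := fun h => hab' (by rw [h, hσ])
      simp [h0, h0.symm, hab, hab', hab.symm, hba]
    · have h := (hmix V G d hG hd hexp σ hσ (fun c => G.Adj c (σ b)) (hdeg _) a).1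
      have h1 : (fun c => if G.Adj c (σ b) then (1 : ℝ) else 0)
          = mateMatrix G σ *ᵥ fun c => if c = b then 1 else 0 := by
        ext c
        simp [Matrix.mulVec, dotProduct, mateMatrix_apply]
      rw [h1, Matrix.mulVec_mulVec, ← pow_succ, ← card_walks] at h
      convert h using 5
      ext v
      simp only [Finset.mem_filter_univ, forall_adj_succ_iff, Finset.mem_singleton,
        Finset.mem_insert, forall_eq_or_imp, forall_eq, if_true, h0.symm, if_false]
      constructor
      · rintro ⟨⟨h1, h2⟩, h3, h4⟩
        exact ⟨h1, h3, h2⟩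
      · rintro ⟨h1, h3, h2⟩
        exact ⟨⟨h1, h2⟩, h3, by rw [h1, h2]; exact hadj⟩
    · rw [Finset.card_pair h0]
      exact key q (hn₂.trans hnn₂)

end Mixing

section Switching

open scoped Classical

variable {V : Type}

/-- `σ` sends every vertex to its partner in some perfect matching of `G`. -/
def IsMate (G : SimpleGraph V) (σ : V → V) : Prop :=
  Function.Involutive σ ∧ ∀ v, G.Adj v (σ v)

/-- Modify `σ` so that it exchanges `p i` and `q i` for every `i`. -/
noncomputable def rewire {I : Type} (σ : V → V) (p q : I → V) : V → V :=
  Function.extend p q (Function.extend q p σ)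

section Rewire

variable {I : Type} {σ : V → V} {p q : I → V}

lemma sumElim_injective_swap (h : Function.Injective (Sum.elim p q)) :
    Function.Injective (Sum.elim q p) := by
  have : Sum.elim q p = Sum.elim p q ∘ Sum.swap := by ext (i | i) <;> rfl
  rw [this]
  exact h.comp Sum.swap_leftInverse.injective

lemma sumElim_injective_comp (h : Function.Injective (Sum.elim p q)) {e : I → I}
    (he : Function.Injective e) : Function.Injective (Sum.elim (p ∘ e) q) := by
  have : Sum.elim (p ∘ e) q = Sum.elim p q ∘ Sum.map e id := by ext (i | i) <;> rfl
  rw [this]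
  exact h.comp (Sum.map_injective.2 ⟨he, Function.injective_id⟩)

lemma rewire_left (h : Function.Injective (Sum.elim p q)) (i : I) :
    rewire σ p q (p i) = q i :=
  (h.comp Sum.inl_injective).extend_apply _ _ i

lemma rewire_right (h : Function.Injective (Sum.elim p q)) (i : I) :
    rewire σ p q (q i) = p i := by
  rw [rewire, Function.extend_apply']
  · exact (h.comp Sum.inr_injective).extend_apply _ _ i
  · rintro ⟨j, hj⟩
    exact Sum.inl_ne_inr (@h (Sum.inl j) (Sum.inr i) hj)

lemma rewire_of_notMem {z : V} (hz : z ∉ Set.range p ∪ Set.range q) :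
    rewire σ p q z = σ z := by
  rw [Set.mem_union, not_or] at hz
  rw [rewire, Function.extend_apply' _ _ _ hz.1, Function.extend_apply' _ _ _ hz.2]

lemma rewire_involutive (hσ : Function.Involutive σ) (h : Function.Injective (Sum.elim p q))
    (hcl : ∀ z ∈ Set.range p ∪ Set.range q, σ z ∈ Set.range p ∪ Set.range q) :
    Function.Involutive (rewire σ p q) := by
  intro z
  by_cases hz : z ∈ Set.range p ∪ Set.range q
  · rcases hz with ⟨i, rfl⟩ | ⟨i, rfl⟩
    · rw [rewire_left h, rewire_right h]
    · rw [rewire_right h, rewire_left h]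
  · rw [rewire_of_notMem hz, rewire_of_notMem, hσ]
    intro hz'
    exact hz (hσ z ▸ hcl _ hz')

lemma rewire_adj {G : SimpleGraph V} (h : Function.Injective (Sum.elim p q))
    (hadj : ∀ i, G.Adj (p i) (q i)) {z : V} (hz : z ∈ Set.range p ∪ Set.range q) :
    G.Adj z (rewire σ p q z) := by
  rcases hz with ⟨i, rfl⟩ | ⟨i, rfl⟩
  · rw [rewire_left h]; exact hadj i
  · rw [rewire_right h]; exact (hadj i).symm

end Rewire

variable [Fintype V]

lemma card_isMate_le {G : SimpleGraph V} {I : Type} {p q p' q' : I → V}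
    (h' : Function.Injective (Sum.elim p' q')) (hadj : ∀ i, G.Adj (p' i) (q' i))
    (hr : Set.range p ∪ Set.range q = Set.range p' ∪ Set.range q') :
    #{σ : V → V | IsMate G σ ∧ ∀ i, σ (p i) = q i}
      ≤ #{σ : V → V | IsMate G σ ∧ ∀ i, σ (p' i) = q' i} := by
  have hq : ∀ σ : V → V, IsMate G σ → (∀ i, σ (p i) = q i) → ∀ i, σ (q i) = p i :=
    fun σ hσ h i => by rw [← h i, hσ.1]
  refine Finset.card_le_card_of_injOn (fun σ => rewire σ p' q') ?_ ?_
  · intro σ hσ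
    simp only [Finset.coe_filter, Finset.mem_univ, true_and, Set.mem_ofPred_eq] at hσ ⊢
    obtain ⟨hσ, hpq⟩ := hσ
    refine ⟨⟨rewire_involutive hσ.1 h' ?_, fun z => ?_⟩, fun i => rewire_left h' i⟩
    · rw [← hr]
      rintro z (⟨i, rfl⟩ | ⟨i, rfl⟩)
      · exact Or.inr ⟨i, (hpq i).symm⟩
      · exact Or.inl ⟨i, (hq σ hσ hpq i).symm⟩
    · by_cases hz : z ∈ Set.range p' ∪ Set.range q'
      · exact rewire_adj h' hadj hz
      · rw [rewire_of_notMem hz]; exact hσ.2 z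
  · intro σ hσ τ hτ hστ
    simp only [Finset.coe_filter, Finset.mem_univ, true_and, Set.mem_ofPred_eq] at hσ hτ
    funext z
    by_cases hz : z ∈ Set.range p ∪ Set.range q
    · rcases hz with ⟨i, rfl⟩ | ⟨i, rfl⟩
      · rw [hσ.2, hτ.2]
      · rw [hq σ hσ.1 hσ.2, hq τ hτ.1 hτ.2]
    · rw [hr] at hz
      have := congrFun hστ z
      simpa only [rewire_of_notMem hz] using this

/-- The sequences `c.1`, `c.2` trace the cycle `c.1 0, c.2 0, c.1 1, c.2 1, …` of `G`, whose first
edge goes from `x` to `y`. -/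
def IsCycleFrom (G : SimpleGraph V) (x y : V) {m : ℕ}
    (c : (Fin (m + 1) → V) × (Fin (m + 1) → V)) : Prop :=
  c.1 0 = x ∧ c.2 0 = y ∧ Function.Injective (Sum.elim c.1 c.2) ∧
    (∀ i, G.Adj (c.1 i) (c.2 i)) ∧ ∀ i, G.Adj (c.2 i) (c.1 (i + 1))

lemma card_isMate_switch {G : SimpleGraph V} {x y : V} {m : ℕ}
    {c : (Fin (m + 1) → V) × (Fin (m + 1) → V)} (hc : IsCycleFrom G x y c) :
    #{σ : V → V | IsMate G σ ∧ ∀ i, σ (c.1 i) = c.2 i}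
      = #{σ : V → V | IsMate G σ ∧ ∀ i, σ (c.2 i) = c.1 (i + 1)} := by
  obtain ⟨-, -, hinj, h1, h2⟩ := hc
  have hr : Set.range (fun i => c.1 (i + 1)) = Set.range c.1 :=
    (Equiv.addRight (1 : Fin (m + 1))).surjective.range_comp c.1
  have hinj' : Function.Injective (Sum.elim c.2 fun i => c.1 (i + 1)) :=
    sumElim_injective_swap (sumElim_injective_comp hinj (add_left_injective 1))
  have hle := card_isMate_le (p := c.1) (q := c.2) hinj' h2 (by rw [hr, Set.union_comm])
  have hge := card_isMate_le (p := c.2) (q := fun i => c.1 (i + 1)) hinj h1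
    (by rw [hr, Set.union_comm])
  exact Nat.le_antisymm (by convert hle) (by convert hge)

lemma sum_card_cycles (G : SimpleGraph V) (x y : V) {m : ℕ} (hm : m ≠ 0) :
    ∑ σ : V → V with IsMate G σ ∧ σ x = y,
        #{c : (Fin (m + 1) → V) × (Fin (m + 1) → V) |
          IsCycleFrom G x y c ∧ ∀ i, σ (c.1 i) = c.2 i}
      = ∑ σ : V → V with IsMate G σ ∧ σ x ≠ y,
        #{c : (Fin (m + 1) → V) × (Fin (m + 1) → V) |
          IsCycleFrom G x y c ∧ ∀ i, σ (c.2 i) = c.1 (i + 1)} := by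
  have h1 := Finset.sum_card_bipartiteAbove_eq_sum_card_bipartiteBelow
    (s := ({σ : V → V | IsMate G σ ∧ σ x = y} : Finset (V → V)))
    (t := ({c | IsCycleFrom G x y c} : Finset ((Fin (m + 1) → V) × (Fin (m + 1) → V))))
    (fun σ c => ∀ i, σ (c.1 i) = c.2 i)
  have h2 := Finset.sum_card_bipartiteAbove_eq_sum_card_bipartiteBelow
    (s := ({σ : V → V | IsMate G σ ∧ σ x ≠ y} : Finset (V → V)))
    (t := ({c | IsCycleFrom G x y c} : Finset ((Fin (m + 1) → V) × (Fin (m + 1) → V))))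
    (fun σ c => ∀ i, σ (c.2 i) = c.1 (i + 1))
  simp only [Finset.bipartiteAbove, Finset.bipartiteBelow, Finset.filter_filter] at h1 h2
  rw [h1, h2]
  refine Finset.sum_congr rfl fun c hc => ?_
  rw [Finset.mem_filter_univ] at hc
  have := card_isMate_switch hc
  obtain ⟨hx, hy, hinj, -, -⟩ := hc
  convert this using 2
  · ext σ
    simp only [Finset.mem_filter_univ, and_assoc]
    refine and_congr_right fun _ => ⟨And.right, fun h => ⟨?_, h⟩⟩
    rw [← hx, h, hy]
  · ext σ
    simp only [Finset.mem_filter_univ, and_assoc]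
    refine and_congr_right fun hσ => ⟨And.right, fun h => ⟨fun hxy => ?_, h⟩⟩
    have h3 := h (Fin.last m)
    rw [Fin.last_add_one, hx] at h3
    have h4 : c.2 (Fin.last m) = c.2 0 := by rw [hy, ← hxy, ← h3, hσ.1]
    have h5 := (hinj.comp Sum.inr_injective) h4
    exact hm (by simpa [Fin.ext_iff] using h5)

lemma card_cycles_through {G : SimpleGraph V} {x y : V} {σ : V → V} (hσ : IsMate G σ)
    (hxy : σ x = y) {m : ℕ} :
    #{c : (Fin (m + 1) → V) × (Fin (m + 1) → V) |
        IsCycleFrom G x y c ∧ ∀ i, σ (c.1 i) = c.2 i}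
      = #{v : Fin (m + 1) → V | v 0 = y ∧ AltCycle G σ v} := by
  have hc1 : ∀ c : (Fin (m + 1) → V) × (Fin (m + 1) → V), (∀ i, σ (c.1 i) = c.2 i) →
      c.1 = σ ∘ c.2 := fun c h => by
    ext i
    simp [← h i, hσ.1 (c.1 i)]
  refine Finset.card_nbij' (fun c => c.2) (fun v => (σ ∘ v, v)) ?_ ?_ ?_ ?_
  · intro c hc
    simp only [Finset.coe_filter, Finset.mem_univ, true_and, Set.mem_ofPred_eq] at hc ⊢
    obtain ⟨⟨hx, hy, hinj, h1, h2⟩, h⟩ := hc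
    have := hc1 c h
    refine ⟨hy, fun i => ?_, ?_⟩
    · have := h2 i
      rwa [hc1 c h] at this
    · rw [← this]
      exact sumElim_injective_swap hinj
  · intro v hv
    simp only [Finset.coe_filter, Finset.mem_univ, true_and, Set.mem_ofPred_eq] at hv ⊢
    obtain ⟨h0, h1, hinj⟩ := hv
    refine ⟨⟨?_, h0, sumElim_injective_swap hinj, fun i => (hσ.2 (v i)).symm, h1⟩,
      fun i => hσ.1 (v i)⟩
    simp [h0, ← hxy, hσ.1 x]
  · intro c hc
    simp only [Finset.coe_filter, Finset.mem_univ, true_and, Set.mem_ofPred_eq] at hc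
    exact Prod.ext (hc1 c hc.2).symm rfl
  · intro v _
    rfl

lemma card_cycles_avoiding {G : SimpleGraph V} {x y : V} {σ : V → V} (hσ : IsMate G σ)
    {m : ℕ} :
    #{c : (Fin (m + 1) → V) × (Fin (m + 1) → V) |
        IsCycleFrom G x y c ∧ ∀ i, σ (c.2 i) = c.1 (i + 1)}
      = #{v : Fin (m + 1) → V | (v 0 = σ y ∧ v (Fin.last m) = x) ∧ AltCycle G σ v} := by
  have hlast : (0 : Fin (m + 1)) - 1 = Fin.last m := by
    rw [sub_eq_iff_eq_add, Fin.last_add_one]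
  refine Finset.card_nbij' (fun c => σ ∘ c.2) (fun v => (fun i => v (i - 1), σ ∘ v)) ?_ ?_ ?_ ?_
  · intro c hc
    simp only [Finset.coe_filter, Finset.mem_univ, true_and, Set.mem_ofPred_eq] at hc ⊢
    obtain ⟨⟨hx, hy, hinj, h1, h2⟩, h⟩ := hc
    have h3 : σ ∘ c.2 = fun i => c.1 (i + 1) := funext h
    have h4 : σ ∘ σ ∘ c.2 = c.2 := by
      ext i
      exact hσ.1 _
    refine ⟨⟨by simp [hy], by rw [h3]; simp [hx]⟩, fun i => ?_, ?_⟩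
    · change G.Adj (σ (c.2 i)) (σ (σ (c.2 (i + 1))))
      rw [hσ.1, h]
      exact h1 (i + 1)
    · rw [h4, h3]
      exact sumElim_injective_comp hinj (add_left_injective 1)
  · intro v hv
    simp only [Finset.coe_filter, Finset.mem_univ, true_and, Set.mem_ofPred_eq] at hv ⊢
    obtain ⟨⟨h0, hl⟩, h1, hinj⟩ := hv
    refine ⟨⟨(congrArg v hlast).trans hl, by simp [h0, hσ.1 y],
      sumElim_injective_comp hinj (sub_left_injective (b := 1)), fun i => ?_, fun i => ?_⟩,
      fun i => ?_⟩
    · simpa using h1 (i - 1)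
    · simpa using (hσ.2 (v i)).symm
    · simpa using hσ.1 (v i)
  · intro c hc
    simp only [Finset.coe_filter, Finset.mem_univ, true_and, Set.mem_ofPred_eq] at hc
    refine Prod.ext (funext fun i => ?_) (funext fun i => hσ.1 _)
    simp [hc.2]
  · intro v _
    exact funext fun i => hσ.1 _

lemma exists_involutive_ne (h : Even (Fintype.card V)) :
    ∃ σ : V → V, Function.Involutive σ ∧ ∀ v, σ v ≠ v := by
  obtain ⟨r, hr⟩ := h
  have e : V ≃ Fin r × Bool := Fintype.equivOfCardEq (by simp [hr, mul_two])
  refine ⟨fun v => e.symm ((e v).1, !(e v).2), fun v => by simp, fun v hv => ?_⟩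
  rw [Equiv.symm_apply_eq] at hv
  simpa using congrArg Prod.snd hv

lemma exists_isMate {G : SimpleGraph V} {m : ℕ} (heven : Even (Fintype.card V))
    (hcyc : ∀ σ : V → V, Function.Involutive σ → (∀ v, σ v ≠ v) → ∀ a,
      ∃ v : Fin (m + 1) → V, v 0 = a ∧ AltCycle G σ v) :
    ∃ σ, IsMate G σ := by
  obtain ⟨σ₀, hσ₀⟩ := exists_involutive_ne heven
  obtain ⟨σ, hσ, hmin⟩ := Finset.exists_min_image
    ({σ : V → V | Function.Involutive σ ∧ ∀ v, σ v ≠ v} : Finset (V → V))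
    (fun σ => #{z | ¬ G.Adj z (σ z)}) ⟨σ₀, by simpa using hσ₀⟩
  simp only [Finset.mem_filter_univ] at hσ hmin
  refine ⟨σ, hσ.1, fun x => ?_⟩
  by_contra hx
  obtain ⟨v, hv0, hadj, hinj⟩ := hcyc σ hσ.1 hσ.2 (σ x)
  set w : Fin (m + 1) → V := fun i => σ (v (i + 1)) with hw
  have hwr : Set.range w = Set.range (σ ∘ v) :=
    (Equiv.addRight (1 : Fin (m + 1))).surjective.range_comp (σ ∘ v)
  have hinj' : Function.Injective (Sum.elim v w) := sumElim_injective_swap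
    (sumElim_injective_comp (sumElim_injective_swap hinj) (add_left_injective 1))
  have hcl : ∀ z ∈ Set.range v ∪ Set.range w, σ z ∈ Set.range v ∪ Set.range w := by
    rw [hwr]
    rintro z (⟨i, rfl⟩ | ⟨i, rfl⟩)
    · exact Or.inr ⟨i, rfl⟩
    · exact Or.inl ⟨i, (hσ.1 _).symm⟩
  have hxmem : x ∈ Set.range v ∪ Set.range w := by
    rw [hwr]
    exact Or.inr ⟨0, by simp [hv0, hσ.1 x]⟩
  refine absurd (hmin (rewire σ v w) ⟨rewire_involutive hσ.1 hinj' hcl, fun z => ?_⟩) (not_le.2 ?_)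
  · by_cases hz : z ∈ Set.range v ∪ Set.range w
    · exact (rewire_adj hinj' hadj hz).ne'
    · rw [rewire_of_notMem hz]; exact hσ.2 z
  · refine Finset.card_lt_card ⟨fun z hz => ?_, fun hsub => ?_⟩
    · simp only [Finset.mem_filter_univ] at hz ⊢
      by_cases hz' : z ∈ Set.range v ∪ Set.range w
      · exact absurd (rewire_adj hinj' hadj hz') hz
      · rwa [rewire_of_notMem hz'] at hz
    · have := hsub (Finset.mem_filter_univ _ |>.2 hx)
      rw [Finset.mem_filter_univ] at this
      exact this (rewire_adj hinj' hadj hxmem)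

/-- The edge set of the perfect matching described by `σ`. -/
noncomputable def mateEdges (σ : V → V) : Finset (Sym2 V) :=
  Finset.univ.image fun v => s(v, σ v)

lemma mem_mateEdges {σ : V → V} (hσ : Function.Involutive σ) {x y : V} :
    s(x, y) ∈ mateEdges σ ↔ σ x = y := by
  simp only [mateEdges, Finset.mem_image, Finset.mem_univ, true_and]
  constructor
  · rintro ⟨v, hv⟩
    rcases Sym2.eq_iff.1 hv with ⟨rfl, rfl⟩ | ⟨rfl, rfl⟩
    · rfl
    · exact hσ _
  · rintro rfl
    exact ⟨x, rfl⟩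

lemma isPM_mateEdges {G : SimpleGraph V} {σ : V → V} (hσ : IsMate G σ) :
    IsPM G (mateEdges σ) := by
  constructor
  · intro e he
    simp only [mateEdges, Finset.mem_image, Finset.mem_univ, true_and] at he
    obtain ⟨v, rfl⟩ := he
    exact hσ.2 v
  · intro v
    refine ⟨s(v, σ v), ⟨(mem_mateEdges hσ.1).2 rfl, Sym2.mem_mk_left _ _⟩, ?_⟩
    rintro e ⟨he, hve⟩
    obtain ⟨w, rfl⟩ := Sym2.mem_iff_exists.1 hve
    rw [(mem_mateEdges hσ.1).1 he]

lemma exists_isMate_mateEdges {G : SimpleGraph V} {M : Finset (Sym2 V)} (hM : IsPM G M) :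
    ∃ σ, IsMate G σ ∧ mateEdges σ = M := by
  have h1 : ∀ v, ∃ w, s(v, w) ∈ M := fun v => by
    obtain ⟨e, ⟨he, hve⟩, -⟩ := hM.2 v
    obtain ⟨w, rfl⟩ := Sym2.mem_iff_exists.1 hve
    exact ⟨w, he⟩
  choose σ hσ using h1
  have huniq : ∀ v w, s(v, w) ∈ M → σ v = w := fun v w h => by
    have := (hM.2 v).unique ⟨hσ v, Sym2.mem_mk_left _ _⟩ ⟨h, Sym2.mem_mk_left _ _⟩
    exact Sym2.congr_right.1 this
  have hinv : Function.Involutive σ := fun v => huniq _ _ (by rw [Sym2.eq_swap]; exact hσ v)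
  refine ⟨σ, ⟨hinv, fun v => hM.1 _ (hσ v)⟩, ?_⟩
  ext e
  induction e using Sym2.ind with
  | _ x y =>
    rw [mem_mateEdges hinv]
    exact ⟨fun h => h ▸ hσ x, huniq x y⟩

lemma card_isPM_eq (G : SimpleGraph V) (P : Finset (Sym2 V) → Prop) :
    Nat.card {M : Finset (Sym2 V) // IsPM G M ∧ P M}
      = #{σ : V → V | IsMate G σ ∧ P (mateEdges σ)} := by
  rw [Nat.card_eq_fintype_card, Fintype.card_subtype]
  symm
  refine Finset.card_bij (fun σ _ => mateEdges σ) ?_ ?_ ?_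
  · intro σ hσ
    rw [Finset.mem_filter_univ] at hσ ⊢
    exact ⟨isPM_mateEdges hσ.1, hσ.2⟩
  · intro σ hσ τ hτ h
    rw [Finset.mem_filter_univ] at hσ hτ
    funext v
    exact ((mem_mateEdges hτ.1.1).1 (h ▸ (mem_mateEdges hσ.1.1).2 rfl)).symm
  · intro M hM
    rw [Finset.mem_filter_univ] at hM
    obtain ⟨σ, hσ, rfl⟩ := exists_isMate_mateEdges hM.1
    exact ⟨σ, by simpa using ⟨hσ, hM.2⟩, rfl⟩

lemma pmCount_eq (G : SimpleGraph V) : pmCount G = #{σ : V → V | IsMate G σ} := by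
  have := card_isPM_eq G fun _ => True
  simpa [pmCount] using this

lemma edgeProb_eq (G : SimpleGraph V) (x y : V) :
    edgeProb G s(x, y) = #{σ : V → V | IsMate G σ ∧ σ x = y} /
      #{σ : V → V | IsMate G σ} := by
  rw [edgeProb, pmCount_eq, card_isPM_eq]
  congr 3
  ext σ
  simp only [Finset.mem_filter_univ]
  exact and_congr_right fun hσ => mem_mateEdges hσ.1

end Switching

lemma cast_sum_bounds {ι : Type*} {s : Finset ι} {f : ι → ℕ} {N t : ℝ}
    (h : ∀ i ∈ s, |(f i : ℝ) - N| ≤ t * N) :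
    #s * ((1 - t) * N) ≤ (∑ i ∈ s, f i : ℕ) ∧ ((∑ i ∈ s, f i : ℕ) : ℝ) ≤ #s * ((1 + t) * N) := by
  rw [Nat.cast_sum, ← nsmul_eq_mul, ← nsmul_eq_mul]
  exact ⟨Finset.card_nsmul_le_sum _ _ _ fun i hi => by linarith [(abs_le.1 (h i hi)).1],
    Finset.sum_le_card_nsmul _ _ _ fun i hi => by linarith [(abs_le.1 (h i hi)).2]⟩

lemma ratio_bounds {X Y d ε t : ℝ} (hX : 0 ≤ X) (hY : 0 ≤ Y) (hXY : 0 < X + Y) (hd : 0 < d)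
    (ht0 : 0 < t) (ht : t ≤ 1 / 4) (htε : 4 * t ≤ ε) (htd : 1 ≤ t * d)
    (h1 : X * d * (1 - t) ≤ Y * (1 + t)) (h2 : Y * (1 - t) ≤ X * d * (1 + t)) :
    (1 - ε) / d ≤ X / (X + Y) ∧ X / (X + Y) ≤ (1 + ε) / d := by
  constructor
  · rw [div_le_div_iff₀ hd hXY]
    have h3 : (X + Y) * (1 - t) ≤ X * d * (1 + 2 * t) := by nlinarith
    have h4 : (1 - 4 * t) * (1 + 2 * t) ≤ 1 - t := by nlinarith
    have h5 : (1 - 4 * t) * (X + Y) ≤ X * d := by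
      by_contra! h
      have : X * d * (1 + 2 * t) < (1 - 4 * t) * (X + Y) * (1 + 2 * t) := by gcongr
      nlinarith
    nlinarith
  · rw [div_le_div_iff₀ hXY hd]
    have h3 : X * d * (1 - t) ≤ (X + Y) * (1 + t) := by nlinarith
    have h4 : 1 + t ≤ (1 + 4 * t) * (1 - t) := by nlinarith
    have h5 : X * d ≤ (1 + 4 * t) * (X + Y) := by
      by_contra! h
      have : (1 + 4 * t) * (X + Y) * (1 - t) < X * d * (1 - t) := by
        apply mul_lt_mul_of_pos_right h; linarith
      nlinarith
    nlinarith

/-- In a `d`-regular robust `(ν,τ)`-expander on an even number `n` of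
vertices (with `d ≥ δn`, `n` large), a perfect matching exists, and each edge lies in a
uniformly random perfect matching with probability `(1 ± ε)/d`. -/
theorem edge_probability_in_uniform_perfect_matching :
    ∀ δ : ℝ, 0 < δ →
    ∃ τ : ℝ, 0 < τ ∧
    ∀ ν : ℝ, 0 < ν →
    ∀ ε : ℝ, 0 < ε →
    ∃ n₀ : ℕ, ∀ n : ℕ, n₀ ≤ n → Even n →
    ∀ d : ℕ, δ * (n : ℝ) ≤ (d : ℝ) →
    ∀ (V : Type) [Fintype V], Fintype.card V = n →
    ∀ G : SimpleGraph V, RegularDeg G d → RobustExpander G ν τ →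
      0 < pmCount G ∧
      ∀ e ∈ G.edgeSet,
        (1 - ε) / (d : ℝ) ≤ edgeProb G e ∧ edgeProb G e ≤ (1 + ε) / (d : ℝ) := by
  classical
  intro δ hδ
  refine ⟨δ / 2, half_pos hδ, fun ν hν ε hε => ?_⟩
  set t : ℝ := min ε 1 / 4 with ht
  have ht0 : 0 < t := by positivity
  have htε : 4 * t ≤ ε := by rw [ht]; linarith [min_le_left ε 1]
  have ht4 : t ≤ 1 / 4 := by rw [ht]; linarith [min_le_right ε 1]
  obtain ⟨q, n₁, hq⟩ := exists_card_altCycle_estimate hδ hν ht0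
  obtain ⟨n₂, hn₂⟩ := exists_nat_ge (1 / (t * δ))
  refine ⟨max n₁ (max n₂ 1), fun n hn heven d hd V _ hV G hG hexp => ?_⟩
  simp only [max_le_iff] at hn
  obtain ⟨hn1, hn2, hn3⟩ := hn
  have : Nonempty V := Fintype.card_pos_iff.1 (by omega)
  have hn0 : (0 : ℝ) < n := by exact_mod_cast hn3
  have hd0 : (0 : ℝ) < d := lt_of_lt_of_le (by positivity) hd
  have htd : 1 ≤ t * d := by
    have h1 : 1 / (t * δ) ≤ n := hn₂.trans (by exact_mod_cast hn2)
    rw [div_le_iff₀ (by positivity)] at h1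
    nlinarith
  have key := hq V G d (by rw [hV]; exact hn1) hG (by rw [hV]; exact hd) hexp
  rw [hV] at key
  set D : ℝ := (d : ℝ) ^ (q + 2) / n with hD
  have hD0 : 0 < D := by positivity
  have hD' : (d : ℝ) ^ (q + 3) / n = d * D := by rw [hD]; ring
  rw [hD'] at key
  have hpos : 0 < pmCount G := by
    obtain ⟨σ, hσ⟩ : ∃ σ, IsMate G σ := by
      refine exists_isMate (m := q + 2) (by rwa [hV]) fun σ hσ hσ' a => ?_
      have h1 := (key σ hσ hσ').1 a
      by_contra! hne
      rw [Finset.filter_false_of_mem (fun v _ hv => hne v hv.1 hv.2), Finset.card_empty,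
        abs_le] at h1
      have : 0 < d * D := by positivity
      push_cast at h1
      nlinarith [h1.1]
    rw [pmCount_eq, Finset.card_pos]
    exact ⟨σ, by simpa using hσ⟩
  refine ⟨hpos, fun e he => ?_⟩
  induction e using Sym2.ind with
  | _ x y =>
  rw [SimpleGraph.mem_edgeSet] at he
  have hsplit : #{σ : V → V | IsMate G σ} = #{σ : V → V | IsMate G σ ∧ σ x = y}
      + #{σ : V → V | IsMate G σ ∧ σ x ≠ y} := by
    rw [← Finset.filter_filter, ← Finset.filter_filter]
    exact (Finset.card_filter_add_card_filter_not _).symm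
  rw [pmCount_eq, hsplit] at hpos
  rw [edgeProb_eq, hsplit]
  have hdc := sum_card_cycles G x y (m := q + 2) (by omega)
  have hthrough : ∀ σ ∈ ({σ : V → V | IsMate G σ ∧ σ x = y} : Finset (V → V)),
      |(#{c : (Fin (q + 3) → V) × (Fin (q + 3) → V) |
        IsCycleFrom G x y c ∧ ∀ i, σ (c.1 i) = c.2 i} : ℝ) - d * D| ≤ t * (d * D) := by
    intro σ hσ
    rw [Finset.mem_filter_univ] at hσ
    rw [card_cycles_through hσ.1 hσ.2]
    exact (key σ hσ.1.1 fun v => (hσ.1.2 v).ne').1 y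
  have havoid : ∀ σ ∈ ({σ : V → V | IsMate G σ ∧ σ x ≠ y} : Finset (V → V)),
      |(#{c : (Fin (q + 3) → V) × (Fin (q + 3) → V) |
        IsCycleFrom G x y c ∧ ∀ i, σ (c.2 i) = c.1 (i + 1)} : ℝ) - D| ≤ t * D := by
    intro σ hσ
    rw [Finset.mem_filter_univ] at hσ
    rw [card_cycles_avoiding hσ.1]
    refine (key σ hσ.1.1 fun v => (hσ.1.2 v).ne').2 (σ y) x ?_ ?_ ?_
    · rintro rfl
      exact hσ.2 (hσ.1.1 y)
    · exact fun h => he.ne' (hσ.1.1.injective h)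
    · rwa [hσ.1.1 y]
  obtain ⟨hX1, hX2⟩ := cast_sum_bounds hthrough
  obtain ⟨hY1, hY2⟩ := cast_sum_bounds havoid
  push_cast
  refine ratio_bounds (Nat.cast_nonneg _) (Nat.cast_nonneg _) (by exact_mod_cast hpos) hd0 ht0 ht4
    htε htd (le_of_mul_le_mul_right ?_ hD0) (le_of_mul_le_mul_right ?_ hD0)
  · have := hX1.trans ((Nat.cast_le.2 hdc.le).trans hY2)
    linarith
  · have := hY1.trans ((Nat.cast_le.2 hdc.ge).trans hX2)
    linarith

end RPM
end

section
/- For every δ > 0 there exists τ > 0 such that for every ν > 0 and every ε > 0 there exists n₀ ∈ ℕ such that the following holds for every even n ≥ n₀ and every integer d ≥ δn: if G is a d-regular robust (ν,τ)-expander on n vertices, N is a matching in G, M is a uniformly random perfect matching of G, X := |M ∩ N|, and Y is a Poisson random variable with parameter |N|/d, then d_TV(X,Y) ≤ ε. -/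
open Finset

namespace RPM

/-- The indicator function of a vertex. -/
def ind {V : Type*} [DecidableEq V] (z v : V) : ℝ := if v = z then 1 else 0

lemma ind_nonneg {V : Type*} [DecidableEq V] (z v : V) : 0 ≤ ind z v := by
  unfold ind
  split_ifs <;> norm_num

section Averaging

variable {V : Type*} [Fintype V] (G : SimpleGraph V) [DecidableRel G.Adj]

/-- The average of `g ∘ σ` over the neighbourhood of a vertex in a `d`-regular graph: one step of
the random walk that moves to a random neighbour and then applies `σ`. -/
noncomputable def avg (d : ℕ) (σ : Equiv.Perm V) (g : V → ℝ) (x : V) : ℝ :=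
  (d : ℝ)⁻¹ * ∑ y ∈ G.neighborFinset x, g (σ y)

variable {G} {d : ℕ}

lemma avg_neg (σ : Equiv.Perm V) (g : V → ℝ) : avg G d σ (-g) = -avg G d σ g := by
  ext x
  simp [avg]

lemma avg_le (hd : 0 < d) (hG : G.IsRegularOfDegree d) (σ : Equiv.Perm V) {g : V → ℝ} {b : ℝ}
    (hg : ∀ v, g v ≤ b) (x : V) : avg G d σ g x ≤ b := by
  have h : ∑ y ∈ G.neighborFinset x, g (σ y) ≤ d * b := by
    calc _ ≤ ∑ y ∈ G.neighborFinset x, b := sum_le_sum fun y _ ↦ hg _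
      _ = d * b := by rw [sum_const, G.card_neighborFinset_eq_degree, hG.degree_eq, nsmul_eq_mul]
  have hd' : (0 : ℝ) < d := by exact_mod_cast hd
  rw [avg, inv_mul_le_iff₀ hd']
  exact h

lemma avg_iterate_neg (σ : Equiv.Perm V) (g : V → ℝ) (t : ℕ) :
    (avg G d σ)^[t] (-g) = -(avg G d σ)^[t] g := by
  induction t with
  | zero => rfl
  | succ t ih => rw [Function.iterate_succ_apply', Function.iterate_succ_apply', ih, avg_neg]

lemma avg_iterate_le (hd : 0 < d) (hG : G.IsRegularOfDegree d) (σ : Equiv.Perm V) {g : V → ℝ}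
    {b : ℝ} (hg : ∀ v, g v ≤ b) (t : ℕ) (x : V) : (avg G d σ)^[t] g x ≤ b := by
  induction t generalizing x with
  | zero => exact hg x
  | succ t ih => rw [Function.iterate_succ_apply']; exact avg_le hd hG σ ih x

lemma le_avg_iterate (hd : 0 < d) (hG : G.IsRegularOfDegree d) (σ : Equiv.Perm V) {g : V → ℝ}
    {a : ℝ} (hg : ∀ v, a ≤ g v) (t : ℕ) (x : V) : a ≤ (avg G d σ)^[t] g x := by
  have := avg_iterate_le hd hG σ (g := -g) (b := -a) (fun v ↦ neg_le_neg (hg v)) t x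
  rw [avg_iterate_neg] at this
  exact neg_le_neg_iff.1 this

lemma sum_avg (hd : 0 < d) (hG : G.IsRegularOfDegree d) (σ : Equiv.Perm V) (g : V → ℝ) :
    ∑ x, avg G d σ g x = ∑ x, g x := by
  have hd' : (d : ℝ) ≠ 0 := by exact_mod_cast hd.ne'
  simp_rw [avg, ← mul_sum]
  rw [inv_mul_eq_iff_eq_mul₀ hd']
  calc ∑ x, ∑ y ∈ G.neighborFinset x, g (σ y)
      = ∑ y, ∑ x ∈ G.neighborFinset y, g (σ y) := by
        refine sum_comm' fun x y ↦ ?_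
        simp [G.adj_comm]
    _ = ∑ y, d * g (σ y) := by
        refine sum_congr rfl fun y _ ↦ ?_
        rw [sum_const, G.card_neighborFinset_eq_degree, hG.degree_eq, nsmul_eq_mul]
    _ = d * ∑ x, g x := by rw [← mul_sum, Equiv.sum_comp σ g]

lemma sum_avg_iterate (hd : 0 < d) (hG : G.IsRegularOfDegree d) (σ : Equiv.Perm V) (g : V → ℝ)
    (t : ℕ) : ∑ x, (avg G d σ)^[t] g x = ∑ x, g x := by
  induction t with
  | zero => rfl
  | succ t ih =>
    rw [← ih]
    simp_rw [Function.iterate_succ_apply']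
    exact sum_avg hd hG σ _

variable [DecidableEq V]

/-- Every set with at least half of the vertices expands by `ν * |V|` vertices, where expansion is
measured with respect to vertices with at least `κ * d` neighbours in the set. -/
def LargeSetsExpand (G : SimpleGraph V) [DecidableRel G.Adj] (d : ℕ) (κ ν : ℝ) : Prop :=
  ∀ S : Finset V, (Fintype.card V : ℝ) / 2 ≤ #S →
    min (Fintype.card V : ℝ) (#S + ν * Fintype.card V) ≤
      #{x | κ * d ≤ (#(G.neighborFinset x ∩ S) : ℝ)}

lemma avg_le_of_many_small (hd : 0 < d) (hG : G.IsRegularOfDegree d) (σ : Equiv.Perm V)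
    {g : V → ℝ} {b s κ : ℝ} (hs : 0 ≤ s) (hg : ∀ v, g v ≤ b) (S : Finset V)
    (hS : ∀ v ∈ S, g (σ v) ≤ b - s) (x : V) (hx : κ * d ≤ (#(G.neighborFinset x ∩ S) : ℝ)) :
    avg G d σ g x ≤ b - s * κ := by
  have hd' : (0 : ℝ) < d := by exact_mod_cast hd
  have h : ∑ y ∈ G.neighborFinset x, g (σ y) ≤
      ∑ y ∈ G.neighborFinset x, (b - if y ∈ S then s else 0) := by
    refine sum_le_sum fun y _ ↦ ?_
    split_ifs with hy
    · exact hS y hy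
    · simpa using hg _
  rw [sum_sub_distrib, sum_const, G.card_neighborFinset_eq_degree, hG.degree_eq, nsmul_eq_mul,
    sum_ite_mem, sum_const, nsmul_eq_mul] at h
  rw [avg, inv_mul_le_iff₀ hd']
  nlinarith [mul_le_mul_of_nonneg_right hx hs]

lemma avg_iterate_le_of_half_small (hd : 0 < d) (hG : G.IsRegularOfDegree d) {κ ν : ℝ}
    (hκ : 0 ≤ κ) (hν : 0 ≤ ν) (hE : LargeSetsExpand G d κ ν) (σ : Equiv.Perm V) {g : V → ℝ}
    {b s : ℝ} (hs : 0 ≤ s) (hg : ∀ v, g v ≤ b)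
    (hh : (Fintype.card V : ℝ) / 2 ≤ #{v | g v ≤ b - s}) {T : ℕ} (hT : 1 ≤ T * ν) (x : V) :
    (avg G d σ)^[T] g x ≤ b - s * κ ^ T := by
  have key : ∀ t : ℕ, min (Fintype.card V : ℝ)
      (Fintype.card V / 2 + t * ν * Fintype.card V) ≤
      #{v | (avg G d σ)^[t] g v ≤ b - s * κ ^ t} := by
    intro t
    induction t with
    | zero => exact (min_le_right _ _).trans (by simpa using hh)
    | succ t ih =>
      set S := ({v | (avg G d σ)^[t] g v ≤ b - s * κ ^ t} : Finset V) with hSdef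
      have hcard : #(S.map σ.symm.toEmbedding) = #S := card_map _
      have hn : (0 : ℝ) ≤ Fintype.card V := by positivity
      have hhalf : (Fintype.card V : ℝ) / 2 ≤ #S := by
        refine le_trans (le_min (by linarith) ?_) ih
        have : 0 ≤ t * ν * Fintype.card V := by positivity
        linarith
      have h1 := hE (S.map σ.symm.toEmbedding) (by rwa [hcard])
      rw [hcard] at h1
      have h2 : #{x | κ * d ≤ (#(G.neighborFinset x ∩ S.map σ.symm.toEmbedding) : ℝ)} ≤
          #{v | (avg G d σ)^[t + 1] g v ≤ b - s * κ ^ (t + 1)} := by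
        refine card_le_card fun v hv ↦ ?_
        rw [mem_filter] at hv ⊢
        refine ⟨mem_univ _, ?_⟩
        rw [Function.iterate_succ_apply', pow_succ, ← mul_assoc]
        refine avg_le_of_many_small hd hG σ (by positivity)
          (avg_iterate_le hd hG σ hg t) _ (fun w hw ↦ ?_) v hv.2
        simp only [mem_map_equiv, Equiv.symm_symm, hSdef, mem_filter] at hw
        exact hw.2
      refine le_trans ?_ (h1.trans (by exact_mod_cast h2))
      refine le_min (min_le_left _ _) ?_
      rcases min_le_iff.1 ih with h | h
      · refine (min_le_left _ _).trans ?_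
        have : 0 ≤ ν * Fintype.card V := by positivity
        linarith
      · refine (min_le_right _ _).trans ?_
        push_cast
        linarith
  have h := key T
  rw [min_eq_left (by nlinarith [(Nat.cast_nonneg (Fintype.card V) : (0 : ℝ) ≤ _)])] at h
  have h' : #{v | (avg G d σ)^[T] g v ≤ b - s * κ ^ T} = Fintype.card V :=
    le_antisymm (card_le_univ _) (by exact_mod_cast h)
  have := (card_eq_iff_eq_univ _).1 h' ▸ mem_univ x
  simpa using this

/-- The oscillation of `g` contracts by a constant factor after `T` steps of averaging. -/
lemma exists_avg_iterate_mem_Icc (hd : 0 < d) (hG : G.IsRegularOfDegree d) {κ ν : ℝ}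
    (hκ : 0 ≤ κ) (hν : 0 ≤ ν) (hE : LargeSetsExpand G d κ ν) (σ : Equiv.Perm V) {T : ℕ}
    (hT : 1 ≤ T * ν) {g : V → ℝ} {a w : ℝ} (hw : 0 ≤ w) (hg : ∀ v, g v ∈ Set.Icc a (a + w)) :
    ∃ a', ∀ v, (avg G d σ)^[T] g v ∈ Set.Icc a' (a' + w * (1 - κ ^ T / 2)) := by
  have hsplit : (Fintype.card V : ℝ) ≤ #{v | g v ≤ a + w - w / 2} +
      #{v | (-g) v ≤ -a - w / 2} := by
    have : Fintype.card V ≤ #(({v | g v ≤ a + w - w / 2} : Finset V) ∪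
        ({v | (-g) v ≤ -a - w / 2} : Finset V)) := by
      rw [← card_univ]
      refine card_le_card fun v _ ↦ ?_
      simp only [mem_union, mem_filter, mem_univ, true_and, Pi.neg_apply]
      rcases le_total (g v) (a + w - w / 2) with h | h
      · exact Or.inl h
      · exact Or.inr (by linarith)
    exact_mod_cast this.trans (card_union_le _ _)
  by_cases hh : (Fintype.card V : ℝ) / 2 ≤ #{v | g v ≤ a + w - w / 2}
  · refine ⟨a, fun v ↦ ⟨le_avg_iterate hd hG σ (fun v ↦ (hg v).1) T v, ?_⟩⟩
    have := avg_iterate_le_of_half_small hd hG hκ hν hE σ (by positivity)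
      (fun v ↦ (hg v).2) hh hT v
    linarith
  · have := fun v ↦ avg_iterate_le_of_half_small (g := -g) hd hG hκ hν hE σ (s := w / 2)
      (b := -a) (by positivity) (fun v ↦ neg_le_neg (hg v).1) (by linarith) hT v
    simp_rw [avg_iterate_neg] at this
    refine ⟨a + w * κ ^ T / 2, fun v ↦ ⟨?_, ?_⟩⟩
    · have := this v
      simp only [Pi.neg_apply] at this
      linarith
    · have := avg_iterate_le hd hG σ (fun v ↦ (hg v).2) T v
      linarith

lemma exists_avg_iterate_mul_mem_Icc (hd : 0 < d) (hG : G.IsRegularOfDegree d) {κ ν : ℝ}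
    (hκ : 0 ≤ κ) (hκ1 : κ ≤ 1) (hν : 0 ≤ ν) (hE : LargeSetsExpand G d κ ν) (σ : Equiv.Perm V)
    {T : ℕ} (hT : 1 ≤ T * ν) {g : V → ℝ} {a w : ℝ} (hw : 0 ≤ w)
    (hg : ∀ v, g v ∈ Set.Icc a (a + w)) (s : ℕ) :
    ∃ a', ∀ v, (avg G d σ)^[T * s] g v ∈ Set.Icc a' (a' + w * (1 - κ ^ T / 2) ^ s) := by
  induction s with
  | zero => exact ⟨a, by simpa using hg⟩
  | succ s ih =>
    obtain ⟨a', ha'⟩ := ih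
    have h1 : κ ^ T ≤ 1 := pow_le_one₀ hκ hκ1
    obtain ⟨a'', ha''⟩ := exists_avg_iterate_mem_Icc hd hG hκ hν hE σ hT
      (w := w * (1 - κ ^ T / 2) ^ s)
      (mul_nonneg hw (pow_nonneg (by linarith) _)) ha'
    refine ⟨a'', fun v ↦ ?_⟩
    rw [mul_add, mul_one, add_comm (T * s), Function.iterate_add_apply, pow_succ, ← mul_assoc]
    exact ha'' v

lemma avg_ind_le (σ : Equiv.Perm V) (z x : V) : avg G d σ (ind z) x ≤ (d : ℝ)⁻¹ := by
  have : ∑ y ∈ G.neighborFinset x, ind z (σ y) ≤ 1 := by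
    simp_rw [ind, ← Equiv.eq_symm_apply, sum_ite_eq']
    split_ifs <;> norm_num
  rw [avg]
  exact mul_le_of_le_one_right (by positivity) this

/-- The walk is close to uniform after constantly many steps. -/
lemma abs_avg_iterate_ind_sub_le (hd : 0 < d) (hG : G.IsRegularOfDegree d) {κ ν : ℝ}
    (hκ : 0 ≤ κ) (hκ1 : κ ≤ 1) (hν : 0 ≤ ν) (hE : LargeSetsExpand G d κ ν) (σ : Equiv.Perm V)
    {T : ℕ} (hT : 1 ≤ T * ν) (s : ℕ) (z x : V) :
    |(avg G d σ)^[T * s + 1] (ind z) x - (Fintype.card V : ℝ)⁻¹| ≤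
      (d : ℝ)⁻¹ * (1 - κ ^ T / 2) ^ s := by
  have h0 : ∀ v, avg G d σ (ind z) v ∈ Set.Icc (0 : ℝ) (0 + (d : ℝ)⁻¹) := fun v ↦
    ⟨le_avg_iterate hd hG σ (ind_nonneg z) 1 v, by simpa using avg_ind_le σ z v⟩
  obtain ⟨a, ha⟩ := exists_avg_iterate_mul_mem_Icc hd hG hκ hκ1 hν hE σ hT (by positivity) h0 s
  have hs := sum_avg_iterate hd hG σ (ind z) (T * s + 1)
  simp only [Function.iterate_succ_apply] at hs ⊢
  have hs' : ∑ x, ind z x = 1 := by simp [ind]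
  rw [hs'] at hs
  have hn : (0 : ℝ) < Fintype.card V := by
    have : Nonempty V := ⟨x⟩
    exact_mod_cast Fintype.card_pos
  set w := (d : ℝ)⁻¹ * (1 - κ ^ T / 2) ^ s
  have h1 : (Fintype.card V : ℝ) * a ≤ 1 := by
    rw [← hs]
    rw [← nsmul_eq_mul, ← card_univ]
    exact card_nsmul_le_sum univ _ a (fun v _ ↦ (ha v).1)
  have h2 : 1 ≤ (Fintype.card V : ℝ) * (a + w) := by
    rw [← hs]
    rw [← nsmul_eq_mul, ← card_univ]
    exact sum_le_card_nsmul univ _ (a + w) (fun v _ ↦ (ha v).2)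
  have h3 : a ≤ (Fintype.card V : ℝ)⁻¹ := by
    rw [← one_div, le_div_iff₀ hn]; linarith
  have h4 : (Fintype.card V : ℝ)⁻¹ ≤ a + w := by
    rw [← one_div, div_le_iff₀ hn]; linarith
  rw [abs_le]
  constructor <;> linarith [(ha x).1, (ha x).2]

end Averaging

section Switching

/-- The fixed-point-free involution `σ` is a perfect matching of `G` together with the possible
extra pair containing `u`, and it agrees with `π` on `F`. -/
structure IsState {V : Type*} (G : SimpleGraph V) (u : V) (F : Finset V) (π : V → V)
    (σ : Equiv.Perm V) : Prop where
  invol : ∀ v, σ (σ v) = v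
  ne : ∀ v, σ v ≠ v
  adj : ∀ v, v ≠ u → σ v ≠ u → G.Adj v (σ v)
  frozen : ∀ v ∈ F, σ v = π v

/-- Replace the pairs `u, σ u` and `y, σ y` by `u, σ y` and `y, σ u`, unless `y` is in `F`. -/
def switch {V : Type*} [DecidableEq V] (u : V) (F : Finset V) (y : V) (σ : Equiv.Perm V) :
    Equiv.Perm V :=
  if y ∈ F then σ else Equiv.swap u y * σ * Equiv.swap u y

/-- The set of all states. -/
noncomputable def states {V : Type*} [Fintype V] [DecidableEq V] (G : SimpleGraph V) (u : V)
    (F : Finset V) (π : V → V) : Finset (Equiv.Perm V) := by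
  classical exact {σ | IsState G u F π σ}

variable {V : Type*} {G : SimpleGraph V}
  {u y : V} {F : Finset V} {π : V → V} {σ : Equiv.Perm V}

lemma IsState.apply_mem (h : IsState G u F π σ) (hF : ∀ v ∈ F, π v ∈ F) {v : V} :
    σ v ∈ F ↔ v ∈ F := by
  have h1 : ∀ v ∈ F, σ v ∈ F := fun v hv ↦ by rw [h.frozen v hv]; exact hF v hv
  exact ⟨fun hv ↦ by simpa [h.invol] using h1 _ hv, h1 v⟩

lemma IsState.adj_apply (h : IsState G u F π σ) (hadj : G.Adj (σ u) y) : G.Adj y (σ y) := by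
  classical
  by_cases hyu : y = u
  · subst hyu
    exact hadj.symm
  · exact h.adj y hyu fun h' ↦ hadj.ne (by rw [← h', h.invol])

variable [DecidableEq V]

lemma switch_switch : switch u F y (switch u F y σ) = σ := by
  unfold switch
  split_ifs
  · rfl
  · ext v
    simp

lemma switch_apply_of_ne (h : IsState G u F π σ) {w : V} (h1 : w ≠ u) (h2 : w ≠ y)
    (h3 : w ≠ σ u) (h4 : w ≠ σ y) : switch u F y σ w = σ w := by
  have h5 : σ w ≠ u := fun h' ↦ h3 (by rw [← h', h.invol])
  have h6 : σ w ≠ y := fun h' ↦ h4 (by rw [← h', h.invol])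
  unfold switch
  split_ifs
  · rfl
  · simp [Equiv.swap_apply_of_ne_of_ne, h1, h2, h5, h6]

lemma switch_apply_self (h : IsState G u F π σ) (hy : y ∉ F) (hadj : G.Adj (σ u) y) :
    switch u F y σ u = σ y := by
  have h1 : σ y ≠ u := fun h' ↦ hadj.ne (by rw [← h', h.invol])
  simp [switch, hy, Equiv.swap_apply_of_ne_of_ne h1 (h.ne y)]

lemma IsState.switch (h : IsState G u F π σ) (hF : ∀ v ∈ F, π v ∈ F) (hu : u ∉ F)
    (hadj : G.Adj (σ u) y) : IsState G u F π (switch u F y σ) := by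
  by_cases hy : y ∈ F
  · simpa [RPM.switch, hy] using h
  refine ⟨fun v ↦ by simp [RPM.switch, hy, h.invol], fun v hv ↦ ?_, fun v hv hv' ↦ ?_,
    fun v hv ↦ ?_⟩
  · simp only [RPM.switch, hy, if_false, Equiv.Perm.mul_apply] at hv
    refine h.ne (Equiv.swap u y v) ?_
    rw [← Equiv.swap_apply_self u y (σ (Equiv.swap u y v)), hv]
  · by_cases hvy : v = y
    · subst hvy
      have : RPM.switch u F v σ v = σ u := by
        simp [RPM.switch, hy, Equiv.swap_apply_of_ne_of_ne (h.ne u) hadj.ne]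
      rw [this]
      exact hadj.symm
    by_cases hvx : v = σ u
    · subst hvx
      have : RPM.switch u F y σ (σ u) = y := by
        simp [RPM.switch, hy, Equiv.swap_apply_of_ne_of_ne (h.ne u) hadj.ne, h.invol]
      rw [this]
      exact hadj
    by_cases hvz : v = σ y
    · subst hvz
      refine absurd ?_ hv'
      have h1 : σ y ≠ u := fun h' ↦ hadj.ne (by rw [← h', h.invol])
      simp [RPM.switch, hy, Equiv.swap_apply_of_ne_of_ne h1 (h.ne y), h.invol]
    rw [switch_apply_of_ne h hv hvy hvx hvz]
    exact h.adj v hv fun h' ↦ hvx (by rw [← h', h.invol])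
  · rw [switch_apply_of_ne h, h.frozen v hv]
    · exact fun h' ↦ hu (h' ▸ hv)
    · exact fun h' ↦ hy (h' ▸ hv)
    · exact fun h' ↦ hu ((h.apply_mem hF).1 (h' ▸ hv))
    · exact fun h' ↦ hy ((h.apply_mem hF).1 (h' ▸ hv))

/-- One step of the switching chain, as an averaging operator on functions of the state. -/
noncomputable def chain {V : Type*} [Fintype V] [DecidableEq V] (G : SimpleGraph V)
    [DecidableRel G.Adj] (d : ℕ) (u : V) (F : Finset V) (g : Equiv.Perm V → ℝ)
    (σ : Equiv.Perm V) : ℝ :=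
  (d : ℝ)⁻¹ * ∑ y ∈ G.neighborFinset (σ u), g (switch u F y σ)

variable [Fintype V]

lemma mem_states : σ ∈ states G u F π ↔ IsState G u F π σ := by simp [states]

variable [DecidableRel G.Adj] {d : ℕ}

lemma sum_mul_chain (hF : ∀ v ∈ F, π v ∈ F) (hu : u ∉ F) (a b : Equiv.Perm V → ℝ) :
    ∑ σ ∈ states G u F π, a σ * chain G d u F b σ =
      ∑ σ ∈ states G u F π, chain G d u F a σ * b σ := by
  have h1 : ∀ σ, a σ * chain G d u F b σ =
      (d : ℝ)⁻¹ * ∑ y ∈ G.neighborFinset (σ u), a σ * b (switch u F y σ) := fun σ ↦ by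
    rw [chain, ← mul_sum]; ring
  have h2 : ∀ σ, chain G d u F a σ * b σ =
      (d : ℝ)⁻¹ * ∑ y ∈ G.neighborFinset (σ u), a (switch u F y σ) * b σ := fun σ ↦ by
    rw [chain, ← sum_mul]; ring
  rw [sum_congr rfl fun σ _ ↦ h1 σ, sum_congr rfl fun σ _ ↦ h2 σ, ← mul_sum, ← mul_sum,
    sum_sigma', sum_sigma']
  congr 1
  have hmaps : ∀ p ∈ (states G u F π).sigma fun σ ↦ G.neighborFinset (σ u),
      (⟨switch u F p.2 p.1, p.2⟩ : (_ : Equiv.Perm V) × V) ∈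
        (states G u F π).sigma fun σ ↦ G.neighborFinset (σ u) := by
    rintro ⟨σ, y⟩ hp
    simp only [mem_sigma, mem_states, SimpleGraph.mem_neighborFinset] at hp ⊢
    refine ⟨hp.1.switch hF hu hp.2, ?_⟩
    by_cases hy : y ∈ F
    · simpa [switch, hy] using hp.2
    · rw [switch_apply_self hp.1 hy hp.2]
      exact (hp.1.adj_apply hp.2).symm
  exact sum_bij' (fun p _ ↦ ⟨switch u F p.2 p.1, p.2⟩) (fun p _ ↦ ⟨switch u F p.2 p.1, p.2⟩)
    hmaps hmaps (fun p _ ↦ by simp [switch_switch]) (fun p _ ↦ by simp [switch_switch])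
    (fun p _ ↦ by simp [switch_switch])

lemma sum_mul_chain_iterate (hF : ∀ v ∈ F, π v ∈ F) (hu : u ∉ F) (t : ℕ)
    (a b : Equiv.Perm V → ℝ) :
    ∑ σ ∈ states G u F π, a σ * (chain G d u F)^[t] b σ =
      ∑ σ ∈ states G u F π, (chain G d u F)^[t] a σ * b σ := by
  induction t generalizing a with
  | zero => rfl
  | succ t ih =>
    rw [Function.iterate_succ_apply']
    rw [sum_mul_chain hF hu, ih, ← Function.iterate_succ_apply]

lemma chain_le (hd : 0 < d) (hG : G.IsRegularOfDegree d) (hF : ∀ v ∈ F, π v ∈ F) (hu : u ∉ F)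
    {g : Equiv.Perm V → ℝ} {b : ℝ} (hg : ∀ σ, IsState G u F π σ → g σ ≤ b)
    (hσ : IsState G u F π σ) : chain G d u F g σ ≤ b := by
  have h : ∑ y ∈ G.neighborFinset (σ u), g (switch u F y σ) ≤ d * b := by
    calc _ ≤ ∑ y ∈ G.neighborFinset (σ u), b := sum_le_sum fun y hy ↦
          hg _ (hσ.switch hF hu (by simpa using hy))
      _ = d * b := by rw [sum_const, G.card_neighborFinset_eq_degree, hG.degree_eq, nsmul_eq_mul]
  have hd' : (0 : ℝ) < d := by exact_mod_cast hd
  rw [chain, inv_mul_le_iff₀ hd']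
  exact h

lemma chain_iterate_nonneg {g : Equiv.Perm V → ℝ} (hg : ∀ σ, 0 ≤ g σ) (t : ℕ)
    (σ : Equiv.Perm V) : 0 ≤ (chain G d u F)^[t] g σ := by
  induction t generalizing σ with
  | zero => exact hg σ
  | succ t ih =>
    rw [Function.iterate_succ_apply']
    exact mul_nonneg (by positivity) (sum_nonneg fun y _ ↦ ih _)

/-- The indicator function of the states in which `u` is paired with `z`. -/
def indPartner {V : Type*} [DecidableEq V] (u z : V) (σ : Equiv.Perm V) : ℝ := ind z (σ u)

lemma chain_indPartner_le (hσ : IsState G u F π σ) (z : V) :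
    chain G d u F (indPartner u z) σ ≤ (d : ℝ)⁻¹ * (#F + 1) := by
  refine mul_le_mul_of_nonneg_left ?_ (by positivity)
  calc ∑ y ∈ G.neighborFinset (σ u), indPartner u z (switch u F y σ)
      ≤ ∑ y ∈ G.neighborFinset (σ u),
          ((if y ∈ F then 1 else 0) + if y = σ z then 1 else 0) := by
        refine sum_le_sum fun y hy ↦ ?_
        by_cases hyF : y ∈ F
        · simp only [hyF, if_true, indPartner, ind]
          split_ifs <;> norm_num
        · simp only [hyF, if_false, zero_add, indPartner, ind]
          rw [switch_apply_self hσ hyF (by simpa using hy)]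
          have : σ y = z → y = σ z := fun h ↦ by rw [← h, hσ.invol]
          split_ifs <;> simp_all
    _ ≤ ∑ y, ((if y ∈ F then 1 else 0) + if y = σ z then 1 else 0 : ℝ) :=
        sum_le_sum_of_subset_of_nonneg (subset_univ _) fun y _ _ ↦ by
          split_ifs <;> norm_num
    _ = #F + 1 := by simp [sum_add_distrib]

lemma chain_iterate_indPartner_le (hd : 0 < d) (hG : G.IsRegularOfDegree d)
    (hF : ∀ v ∈ F, π v ∈ F) (hu : u ∉ F) (z : V) (t : ℕ) (hσ : IsState G u F π σ) :
    (chain G d u F)^[t + 1] (indPartner u z) σ ≤ (d : ℝ)⁻¹ * (#F + 1) := by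
  induction t generalizing σ with
  | zero => exact chain_indPartner_le hσ z
  | succ t ih =>
    rw [Function.iterate_succ_apply']
    exact chain_le hd hG hF hu (fun σ hσ ↦ ih hσ) hσ

/-- Changing the permutation on four vertices hardly affects the walk. -/
lemma abs_avg_iterate_ind_sub_avg_iterate_ind_le (hd : 0 < d) (hG : G.IsRegularOfDegree d)
    {σ τ : Equiv.Perm V} {D : Finset V} (hD : ∀ v, v ∉ D → σ v = τ v) {z : V}
    (hz : ∀ v, σ v = z ↔ τ v = z) (t : ℕ) (x : V) :
    |(avg G d σ)^[t + 1] (ind z) x - (avg G d τ)^[t + 1] (ind z) x| ≤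
      t * (#D * ((d : ℝ)⁻¹ * (d : ℝ)⁻¹)) := by
  induction t generalizing x with
  | zero =>
    have : avg G d σ (ind z) = avg G d τ (ind z) := by
      ext x
      simp [avg, ind, hz]
    simp [this]
  | succ t ih =>
    have hd' : (0 : ℝ) < d := by exact_mod_cast hd
    rw [Function.iterate_succ_apply' _ (t + 1), Function.iterate_succ_apply' _ (t + 1)]
    set g := (avg G d σ)^[t + 1] (ind z) with hg
    set g' := (avg G d τ)^[t + 1] (ind z)
    have hg0 : ∀ v, 0 ≤ g v := le_avg_iterate hd hG σ (ind_nonneg z) (t + 1)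
    have hg1 : ∀ v, g v ≤ (d : ℝ)⁻¹ := fun v ↦ by
      rw [hg, Function.iterate_succ_apply]
      exact avg_iterate_le hd hG σ (avg_ind_le σ z) t v
    set E := (t : ℝ) * (#D * ((d : ℝ)⁻¹ * (d : ℝ)⁻¹))
    have hterm : ∀ y, |g (σ y) - g' (τ y)| ≤ E + if y ∈ D then (d : ℝ)⁻¹ else 0 := fun y ↦ by
      have h1 := abs_le.1 (ih (τ y))
      by_cases hy : y ∈ D
      · simp only [hy, if_true]
        rw [abs_le]
        constructor <;> linarith [hg0 (σ y), hg1 (σ y), hg0 (τ y), hg1 (τ y), h1.1, h1.2]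
      · simpa [hy, hD y hy] using ih (τ y)
    calc |avg G d σ g x - avg G d τ g' x|
        = (d : ℝ)⁻¹ * |∑ y ∈ G.neighborFinset x, (g (σ y) - g' (τ y))| := by
          rw [avg, avg, ← mul_sub, ← sum_sub_distrib, abs_mul, abs_of_nonneg (inv_nonneg.2 hd'.le)]
      _ ≤ (d : ℝ)⁻¹ * (d * E + #D * (d : ℝ)⁻¹) := by
          refine mul_le_mul_of_nonneg_left ?_ (by positivity)
          refine (abs_sum_le_sum_abs _ _).trans ((sum_le_sum fun y _ ↦ hterm y).trans ?_)
          rw [sum_add_distrib, sum_const, G.card_neighborFinset_eq_degree, hG.degree_eq,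
            nsmul_eq_mul, sum_ite_mem, sum_const, nsmul_eq_mul]
          gcongr
          exact inter_subset_right
      _ = ((t + 1 : ℕ) : ℝ) * (#D * ((d : ℝ)⁻¹ * (d : ℝ)⁻¹)) := by
          push_cast
          simp only [E]
          field_simp

end Switching

section EdgeProbability

variable {V : Type*} [Fintype V] [DecidableEq V] {G : SimpleGraph V} [DecidableRel G.Adj] {d : ℕ}
  {u : V} {F : Finset V} {π : V → V}

/-- The switching chain is close to the walk in which the matching stays fixed. -/
lemma abs_chain_iterate_sub_le (hd : 0 < d) (hG : G.IsRegularOfDegree d)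
    (hF : ∀ v ∈ F, π v ∈ F) (hu : u ∉ F) {z : V} (hzu : z ≠ u) (hzF : z ∉ F) (t : ℕ)
    {σ : Equiv.Perm V} (hσ : IsState G u F π σ) (hσz : σ u ≠ z) :
    |(chain G d u F)^[t + 1] (indPartner u z) σ - (avg G d σ)^[t + 1] (ind z) (σ u)| ≤
      t * ((#F + 2) * (#F + 1) + 4 * t) * ((d : ℝ)⁻¹ * (d : ℝ)⁻¹) := by
  induction t generalizing σ with
  | zero =>
    have : chain G d u F (indPartner u z) σ = avg G d σ (ind z) (σ u) := by
      unfold chain avg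
      congr 1
      refine sum_congr rfl fun y hy ↦ ?_
      by_cases hyF : y ∈ F
      · have h1 : σ y ≠ z := fun h ↦ hzF (h ▸ (hσ.apply_mem hF).2 hyF)
        simp [switch, hyF, indPartner, ind, h1, hσz]
      · rw [indPartner, switch_apply_self hσ hyF (by simpa using hy)]
    simp [this]
  | succ t ih =>
    have hd' : (0 : ℝ) < d := by exact_mod_cast hd
    rw [Function.iterate_succ_apply' _ (t + 1), Function.iterate_succ_apply' _ (t + 1)]
    set h := (chain G d u F)^[t + 1] (indPartner u z) with hh
    set g := (avg G d σ)^[t + 1] (ind z) with hg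
    set D := (d : ℝ)⁻¹ with hD
    have hDpos : 0 < D := inv_pos.2 hd'
    set E := t * ((#F + 2) * (#F + 1) + 4 * t) * (D * D) with hE
    have hE0 : 0 ≤ E := by positivity
    set B := insert z (insert (σ z) F)
    have hB : #B ≤ #F + 2 := (card_insert_le _ _).trans
      (Nat.succ_le_succ (card_insert_le _ _))
    have hterm : ∀ y ∈ G.neighborFinset (σ u), |h (switch u F y σ) - g (σ y)| ≤
        (E + t * (4 * (D * D))) + if y ∈ B then (#F + 1) * D else 0 := fun y hy ↦ by
      rw [SimpleGraph.mem_neighborFinset] at hy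
      have hst := hσ.switch hF hu hy
      by_cases hyB : y ∈ B
      · have h1 : h (switch u F y σ) ≤ D * (#F + 1) :=
          chain_iterate_indPartner_le hd hG hF hu z t hst
        have h2 : 0 ≤ h (switch u F y σ) :=
          chain_iterate_nonneg (fun σ ↦ ind_nonneg z (σ u)) _ _
        have h3 : 0 ≤ g (σ y) := le_avg_iterate hd hG σ (ind_nonneg z) (t + 1) _
        have h4 : g (σ y) ≤ D := by
          rw [hg, Function.iterate_succ_apply]
          exact avg_iterate_le hd hG σ (avg_ind_le σ z) t _
        have h5 : D ≤ (#F + 1) * D := le_mul_of_one_le_left hDpos.le (by simp)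
        have h6 : 0 ≤ t * (4 * (D * D)) := by positivity
        simp only [hyB, if_true]
        rw [abs_le]
        constructor <;> linarith
      · simp only [hyB, if_false, add_zero]
        simp only [B, mem_insert, not_or] at hyB
        obtain ⟨hyz, hyσz, hyF⟩ := hyB
        have hself := switch_apply_self hσ hyF hy
        have hσy : σ y ≠ z := fun h ↦ hyσz (by rw [← h, hσ.invol])
        have h1 := ih hst (by rwa [hself])
        rw [hself] at h1
        have h2 := abs_avg_iterate_ind_sub_avg_iterate_ind_le hd hG (σ := switch u F y σ) (τ := σ)
          (D := {u, y, σ u, σ y}) (z := z) (fun v hv ↦ by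
            simp only [mem_insert, mem_singleton, not_or] at hv
            exact switch_apply_of_ne hσ hv.1 hv.2.1 hv.2.2.1 hv.2.2.2) (fun v ↦ by
            have e1 : switch u F y σ z = σ z :=
              switch_apply_of_ne hσ hzu (Ne.symm hyz) (Ne.symm hσz) (Ne.symm hσy)
            constructor
            · intro hv
              rw [← hst.invol v, hv, e1, hσ.invol]
            · intro hv
              rw [← hσ.invol v, hv, ← e1, hst.invol]) t (σ y)
        have h3 : (#({u, y, σ u, σ y} : Finset V) : ℝ) ≤ 4 := by exact_mod_cast card_le_four
        have h4 : t * (#({u, y, σ u, σ y} : Finset V) * (D * D)) ≤ t * (4 * (D * D)) := by gcongr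
        exact (abs_sub_le _ _ _).trans (add_le_add h1 (h2.trans h4))
    calc |chain G d u F h σ - avg G d σ g (σ u)|
        = D * |∑ y ∈ G.neighborFinset (σ u), (h (switch u F y σ) - g (σ y))| := by
          rw [chain, avg, ← mul_sub, ← sum_sub_distrib, abs_mul, abs_of_nonneg hDpos.le]
      _ ≤ D * (d * (E + t * (4 * (D * D))) + (#F + 2) * ((#F + 1) * D)) := by
          refine mul_le_mul_of_nonneg_left ?_ hDpos.le
          refine (abs_sum_le_sum_abs _ _).trans ((sum_le_sum hterm).trans ?_)
          rw [sum_add_distrib, sum_const, G.card_neighborFinset_eq_degree, hG.degree_eq,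
            nsmul_eq_mul, sum_ite_mem, sum_const, nsmul_eq_mul]
          gcongr
          exact_mod_cast (card_le_card inter_subset_right).trans hB
      _ = E + t * (4 * (D * D)) + (#F + 2) * (#F + 1) * (D * D) := by
          have : D * d = 1 := inv_mul_cancel₀ hd'.ne'
          linear_combination (E + t * (4 * (D * D))) * this
      _ ≤ _ := by
          rw [hE]
          push_cast
          nlinarith [mul_pos hDpos hDpos, (Nat.cast_nonneg t : (0 : ℝ) ≤ t)]

/-- The number of states in which `u` has a given partner hardly depends on that partner. -/
lemma card_partner_le {E : ℝ} (hF : ∀ v ∈ F, π v ∈ F) (hu : u ∉ F) {ℓ : ℕ} {x z : V}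
    (hx : ∀ σ, IsState G u F π σ → σ u = x →
      (Fintype.card V : ℝ)⁻¹ - E ≤ (chain G d u F)^[ℓ] (indPartner u z) σ)
    (hz : ∀ σ, IsState G u F π σ → σ u = z →
      (chain G d u F)^[ℓ] (indPartner u x) σ ≤ (Fintype.card V : ℝ)⁻¹ + E) :
    ((Fintype.card V : ℝ)⁻¹ - E) * #{σ ∈ states G u F π | σ u = x} ≤
      ((Fintype.card V : ℝ)⁻¹ + E) * #{σ ∈ states G u F π | σ u = z} := by
  have h := sum_mul_chain_iterate (G := G) (d := d) hF hu ℓ (indPartner u x) (indPartner u z)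
  simp only [indPartner, ind, ite_mul, mul_ite, one_mul, zero_mul, mul_one, mul_zero,
    ← sum_filter] at h
  calc _ = ∑ σ ∈ states G u F π with σ u = x, ((Fintype.card V : ℝ)⁻¹ - E) := by
        rw [sum_const, nsmul_eq_mul, mul_comm]
    _ ≤ _ := sum_le_sum fun σ hσ ↦ by
        rw [mem_filter, mem_states] at hσ
        exact hx σ hσ.1 hσ.2
    _ = _ := h
    _ ≤ ∑ σ ∈ states G u F π with σ u = z, ((Fintype.card V : ℝ)⁻¹ + E) :=
      sum_le_sum fun σ hσ ↦ by
        rw [mem_filter, mem_states] at hσ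
        exact hz σ hσ.1 hσ.2
    _ = _ := by rw [sum_const, nsmul_eq_mul, mul_comm]

/-- The perfect matchings of `G`, as involutions, which agree with `π` on `F`. -/
def matchings {V : Type*} [Fintype V] [DecidableEq V] (G : SimpleGraph V) [DecidableRel G.Adj]
    (F : Finset V) (π : V → V) : Finset (Equiv.Perm V) :=
  {σ | (∀ v, σ (σ v) = v) ∧ (∀ v, G.Adj v (σ v)) ∧ ∀ v ∈ F, σ v = π v}

lemma mem_matchings {σ : Equiv.Perm V} : σ ∈ matchings G F π ↔
    (∀ v, σ (σ v) = v) ∧ (∀ v, G.Adj v (σ v)) ∧ ∀ v ∈ F, σ v = π v := by simp [matchings]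

lemma mem_matchings_iff {σ : Equiv.Perm V} :
    σ ∈ matchings G F π ↔ σ ∈ states G u F π ∧ G.Adj u (σ u) := by
  rw [mem_matchings, mem_states]
  constructor
  · rintro ⟨h1, h2, h3⟩
    exact ⟨⟨h1, fun v ↦ (h2 v).ne', fun v _ _ ↦ h2 v, h3⟩, h2 u⟩
  · rintro ⟨h1, h2⟩
    refine ⟨h1.invol, fun v ↦ ?_, h1.frozen⟩
    by_cases hv : v = u
    · rwa [hv]
    by_cases hv' : σ v = u
    · rw [hv', ← h1.invol v, hv']
      exact h2.symm
    · exact h1.adj v hv hv'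

lemma card_matchings (hF : ∀ v ∈ F, π v ∈ F) (hu : u ∉ F) :
    #(matchings G F π) =
      ∑ x ∈ G.neighborFinset u \ F, #{σ ∈ states G u F π | σ u = x} := by
  rw [card_eq_sum_card_fiberwise (f := fun σ ↦ σ u) (t := G.neighborFinset u \ F)]
  · refine sum_congr rfl fun x hx ↦ congrArg card ?_
    ext σ
    simp only [mem_sdiff, SimpleGraph.mem_neighborFinset] at hx
    simp only [mem_filter, mem_matchings_iff (u := u)]
    constructor
    · exact fun h ↦ ⟨h.1.1, h.2⟩
    · exact fun h ↦ ⟨⟨h.1, h.2 ▸ hx.1⟩, h.2⟩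
  · intro σ hσ
    have hσ' := (mem_matchings_iff (u := u)).1 (mem_coe.1 hσ)
    simpa using ⟨hσ'.2, fun h ↦ hu (((mem_states.1 hσ'.1).apply_mem hF).1 h)⟩

lemma matchings_insert (hadj : G.Adj u (π u)) (hπ : π (π u) = u) :
    matchings G (insert u (insert (π u) F)) π = {σ ∈ states G u F π | σ u = π u} := by
  ext σ
  simp only [mem_filter, mem_states]
  rw [mem_matchings]
  constructor
  · rintro ⟨h1, h2, h3⟩
    exact ⟨⟨h1, fun v ↦ (h2 v).ne', fun v _ _ ↦ h2 v, fun v hv ↦ h3 v (by simp [hv])⟩,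
      h3 u (by simp)⟩
  · rintro ⟨h1, h2⟩
    have h3 := mem_matchings.1 ((mem_matchings_iff (u := u)).2 ⟨mem_states.2 h1, h2 ▸ hadj⟩)
    refine ⟨h3.1, h3.2.1, fun v hv ↦ ?_⟩
    rcases mem_insert.1 hv with rfl | hv
    · exact h2
    rcases mem_insert.1 hv with rfl | hv
    · rw [hπ, ← h2, h1.invol]
    · exact h3.2.2 v hv

lemma abs_sub_le_of_approx {η Z A c d : ℝ} (hη : 0 ≤ η) (hη' : η ≤ 1 / 8) (hZ : 0 ≤ Z)
    (hA : 0 ≤ A) (hc : (1 - η) * d ≤ c) (h1 : (1 - η) * Z ≤ (1 + η) * (d * A))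
    (h2 : c * ((1 - η) * A) ≤ (1 + η) * Z) : |d * A - Z| ≤ 8 * η * Z := by
  have h3 : (1 - η) ^ 2 * (d * A) ≤ (1 + η) * Z := by
    refine le_trans ?_ h2
    calc _ = (1 - η) * d * ((1 - η) * A) := by ring
      _ ≤ _ := by gcongr; exact mul_nonneg (by linarith) hA
  rw [abs_le]
  constructor
  · have : (1 + η) * ((1 - 8 * η) * Z) ≤ (1 + η) * (d * A) := by
      refine le_trans ?_ h1
      rw [← mul_assoc]
      refine mul_le_mul_of_nonneg_right ?_ hZ
      linarith [mul_nonneg hη hη]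
    have := le_of_mul_le_mul_left this (by linarith)
    linarith
  · have : (1 - η) ^ 2 * (d * A) ≤ (1 - η) ^ 2 * ((1 + 8 * η) * Z) := by
      refine h3.trans ?_
      rw [← mul_assoc]
      refine mul_le_mul_of_nonneg_right ?_ hZ
      have : 0 ≤ η * (5 - 15 * η + 8 * η ^ 2) :=
        mul_nonneg hη (by linarith [sq_nonneg η])
      linarith
    have := le_of_mul_le_mul_left this (pow_pos (by linarith) 2)
    linarith

/-- Given that a random perfect matching agrees with `π` on `F`, the pair `u, π u` is in the
matching with probability close to `1 / d`. -/
lemma abs_mul_card_matchings_insert_sub_le {δ κ ν η : ℝ} (hδ : 0 < δ) (hκ : 0 < κ) (hκ1 : κ ≤ 1)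
    (hν : 0 < ν) (hη : 0 < η) (hη1 : η ≤ 1) (R : ℕ) :
    ∃ n₀ : ℕ, ∀ (V : Type) [Fintype V] [DecidableEq V] (G : SimpleGraph V) [DecidableRel G.Adj]
      (d : ℕ), n₀ ≤ Fintype.card V → δ * Fintype.card V ≤ d → G.IsRegularOfDegree d →
      LargeSetsExpand G d κ ν → ∀ (F : Finset V) (π : V → V) (u : V), #F ≤ R →
      (∀ v ∈ F, π v ∈ F) → u ∉ F → G.Adj u (π u) → π (π u) = u →
      |(d : ℝ) * #(matchings G (insert u (insert (π u) F)) π) - #(matchings G F π)| ≤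
        η * #(matchings G F π) := by
  obtain ⟨η₁, rfl⟩ : ∃ x, η = 8 * x := ⟨η / 8, by ring⟩
  have hη₁0 : 0 < η₁ := by linarith
  obtain ⟨T, hT⟩ := exists_nat_ge (1 / ν)
  have hTν : 1 ≤ T * ν := by rwa [div_le_iff₀ hν] at hT
  have hq0 : 0 ≤ 1 - κ ^ T / 2 := by linarith [pow_le_one₀ hκ.le hκ1 (n := T)]
  have hq1 : 1 - κ ^ T / 2 < 1 := by linarith [pow_pos hκ T]
  obtain ⟨s, hs⟩ := exists_pow_lt_of_lt_one (show 0 < η₁ * δ / 2 by positivity) hq1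
  set C : ℝ := (T * s : ℕ) * ((R + 2) * (R + 1) + 4 * (T * s : ℕ)) with hC
  have hC0 : 0 ≤ C := by positivity
  obtain ⟨n₀, hn₀⟩ := exists_nat_ge (max 1 (max (2 * C / (δ ^ 2 * η₁)) (R / (η₁ * δ))))
  refine ⟨n₀, fun V _ _ G _ d hn hdn hG hE F π u hFR hF hu hadj hπ ↦ ?_⟩
  set n : ℝ := (Fintype.card V : ℝ) with hndef
  have hn' := hn₀.trans (Nat.cast_le.2 hn : (n₀ : ℝ) ≤ Fintype.card V)
  rw [← hndef, max_le_iff, max_le_iff, div_le_iff₀ (by positivity), div_le_iff₀ (by positivity)]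
    at hn'
  obtain ⟨hn1, hnC, hnR⟩ := hn'
  have hnpos : 0 < n := by linarith
  have hdpos : (0 : ℝ) < d := lt_of_lt_of_le (by positivity) hdn
  have hd : 0 < d := by exact_mod_cast hdpos
  have hdinv : (d : ℝ)⁻¹ ≤ n⁻¹ * δ⁻¹ := by
    rw [← mul_inv, mul_comm]
    exact inv_anti₀ (by positivity) hdn
  set E := η₁ * n⁻¹ with hEdef
  have hE0 : 0 ≤ E := by positivity
  have hclose : ∀ z, z ≠ u → z ∉ F → ∀ σ, IsState G u F π σ → σ u ≠ z →
      |(chain G d u F)^[T * s + 1] (indPartner u z) σ - n⁻¹| ≤ E := by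
    intro z hzu hzF σ hσ hσz
    have h1 := abs_chain_iterate_sub_le hd hG hF hu hzu hzF (T * s) hσ hσz
    have h2 := abs_avg_iterate_ind_sub_le hd hG hκ.le hκ1 hν.le hE σ hTν s z (σ u)
    have h3 : (d : ℝ)⁻¹ * (1 - κ ^ T / 2) ^ s ≤ E / 2 := by
      calc (d : ℝ)⁻¹ * (1 - κ ^ T / 2) ^ s ≤ (n⁻¹ * δ⁻¹) * (η₁ * δ / 2) := by gcongr
        _ = E / 2 := by rw [hEdef]; field_simp
    have h4 : ((T * s : ℕ) : ℝ) * ((#F + 2) * (#F + 1) + 4 * (T * s : ℕ)) *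
        ((d : ℝ)⁻¹ * (d : ℝ)⁻¹) ≤ E / 2 := by
      calc _ ≤ C * ((n⁻¹ * δ⁻¹) * (n⁻¹ * δ⁻¹)) := by rw [hC]; gcongr
        _ = 2 * C * (n⁻¹ * n⁻¹ * δ⁻¹ * δ⁻¹ / 2) := by ring
        _ ≤ n * (δ ^ 2 * η₁) * (n⁻¹ * n⁻¹ * δ⁻¹ * δ⁻¹ / 2) := by gcongr
        _ = E / 2 := by rw [hEdef]; field_simp
    calc _ ≤ _ := abs_sub_le _ ((avg G d σ)^[T * s + 1] (ind z) (σ u)) _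
      _ ≤ E / 2 + E / 2 := add_le_add (h1.trans h4) (h2.trans h3)
      _ = E := by ring
  have hcard : ∀ x z, x ≠ u → x ∉ F → z ≠ u → z ∉ F →
      (n⁻¹ - E) * #{σ ∈ states G u F π | σ u = x} ≤
      (n⁻¹ + E) * #{σ ∈ states G u F π | σ u = z} := by
    intro x z hxu hxF hzu hzF
    rcases eq_or_ne x z with rfl | hxz
    · gcongr
      linarith
    · refine card_partner_le (d := d) (ℓ := T * s + 1) hF hu (fun σ hσ h ↦ ?_) (fun σ hσ h ↦ ?_)
      · have := abs_le.1 (hclose z hzu hzF σ hσ (by rwa [h]))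
        linarith [this.1]
      · have := abs_le.1 (hclose x hxu hxF σ hσ (by rw [h]; exact hxz.symm))
        linarith [this.2]
  have hπF : π u ∉ F := fun h ↦ hu (hπ ▸ hF _ h)
  rw [matchings_insert hadj hπ]
  set A : ℝ := (#{σ ∈ states G u F π | σ u = π u} : ℝ) with hA
  have hA0 : 0 ≤ A := by positivity
  have hcm : (#(matchings G F π) : ℝ) =
      ∑ x ∈ G.neighborFinset u \ F, (#{σ ∈ states G u F π | σ u = x} : ℝ) := by
    rw [card_matchings hF hu]; push_cast; rfl
  set Z : ℝ := (#(matchings G F π) : ℝ) with hZ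
  have hZ0 : 0 ≤ Z := by positivity
  have hup : (#(G.neighborFinset u \ F) : ℝ) ≤ d := by
    rw [← hG.degree_eq u, ← G.card_neighborFinset_eq_degree]
    exact_mod_cast card_le_card sdiff_subset
  have hlow : (d : ℝ) - R ≤ #(G.neighborFinset u \ F) := by
    have := le_card_sdiff F (G.neighborFinset u)
    rw [G.card_neighborFinset_eq_degree, hG.degree_eq] at this
    have h' : d ≤ #(G.neighborFinset u \ F) + R := by omega
    have : (d : ℝ) ≤ #(G.neighborFinset u \ F) + R := by exact_mod_cast h'
    linarith
  have hmem : ∀ x ∈ G.neighborFinset u \ F, x ≠ u ∧ x ∉ F := fun x hx ↦ by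
    simp only [mem_sdiff, SimpleGraph.mem_neighborFinset] at hx
    exact ⟨hx.1.ne', hx.2⟩
  have h1 : (n⁻¹ - E) * Z ≤ d * ((n⁻¹ + E) * A) := by
    rw [hcm, mul_sum]
    calc _ ≤ ∑ x ∈ G.neighborFinset u \ F, (n⁻¹ + E) * A := sum_le_sum fun x hx ↦
          hcard x (π u) (hmem x hx).1 (hmem x hx).2 hadj.ne' hπF
      _ = #(G.neighborFinset u \ F) * ((n⁻¹ + E) * A) := by rw [sum_const, nsmul_eq_mul]
      _ ≤ _ := by gcongr
  have h2 : #(G.neighborFinset u \ F) * ((n⁻¹ - E) * A) ≤ (n⁻¹ + E) * Z := by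
    rw [hcm, mul_sum]
    calc _ = ∑ x ∈ G.neighborFinset u \ F, (n⁻¹ - E) * A := by rw [sum_const, nsmul_eq_mul]
      _ ≤ _ := sum_le_sum fun x hx ↦
          hcard (π u) x hadj.ne' hπF (hmem x hx).1 (hmem x hx).2
  have e1 : n⁻¹ - E = n⁻¹ * (1 - η₁) := by rw [hEdef]; ring
  have e2 : n⁻¹ + E = n⁻¹ * (1 + η₁) := by rw [hEdef]; ring
  have hninv : 0 < n⁻¹ := by positivity
  rw [e1, e2] at h1 h2
  have h1' : (1 - η₁) * Z ≤ (1 + η₁) * (d * A) := by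
    refine le_of_mul_le_mul_left ?_ hninv
    linarith
  have h2' : #(G.neighborFinset u \ F) * ((1 - η₁) * A) ≤ (1 + η₁) * Z := by
    refine le_of_mul_le_mul_left ?_ hninv
    linarith
  have hηle : η₁ ≤ 1 / 8 := by linarith
  have hRd : (R : ℝ) ≤ η₁ * d := by
    calc (R : ℝ) ≤ n * (η₁ * δ) := hnR
      _ = η₁ * (δ * n) := by ring
      _ ≤ η₁ * d := by gcongr
  exact abs_sub_le_of_approx hη₁0.le hηle hZ0 hA0 (by linarith) h1' h2'

end EdgeProbability

section PoissonConvergence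

lemma exp_sub_sum_le {x : ℝ} (hx : 0 ≤ x) (n : ℕ) :
    Real.exp x - ∑ m ∈ range n, x ^ m / (m.factorial : ℝ) ≤
      x ^ n / n.factorial * Real.exp x := by
  have h : HasSum (fun m : ℕ ↦ x ^ m / (m.factorial : ℝ)) (Real.exp x) := by
    rw [Real.exp_eq_exp_ℝ]
    exact NormedSpace.expSeries_div_hasSum_exp x
  have h1 := h.summable.sum_add_tsum_nat_add n
  rw [h.tsum_eq] at h1
  rw [← h1, add_sub_cancel_left, h1, ← h.tsum_eq, ← tsum_mul_left]
  refine ((summable_nat_add_iff n).2 h.summable).tsum_le_tsum (fun m ↦ ?_) (h.summable.mul_left _)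
  have h2 : ((n.factorial * m.factorial : ℕ) : ℝ) ≤ ((m + n).factorial : ℕ) := by
    rw [add_comm m]
    exact_mod_cast Nat.le_of_dvd (Nat.factorial_pos _)
      (Nat.factorial_mul_factorial_dvd_factorial_add n m)
  rw [div_mul_div_comm, ← pow_add, add_comm n m]
  push_cast at h2
  gcongr

lemma abs_exp_sub_sum_le (x : ℝ) (n : ℕ) :
    |Real.exp x - ∑ m ∈ range n, x ^ m / (m.factorial : ℝ)| ≤
      |x| ^ n / n.factorial * Real.exp |x| := by
  refine le_trans ?_ (exp_sub_sum_le (abs_nonneg x) n)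
  have h := Complex.norm_exp_sub_sum_le_exp_norm_sub_sum x n
  rw [Complex.norm_real, Real.norm_eq_abs] at h
  refine le_trans (le_of_eq ?_) h
  rw [← Real.norm_eq_abs, ← Complex.norm_real]
  push_cast
  rfl

lemma hasSum_poissonPMF (lam : ℝ) : HasSum (poissonPMF lam) 1 := by
  have h := (NormedSpace.expSeries_div_hasSum_exp lam).mul_left (Real.exp (-lam))
  rw [← Real.exp_eq_exp_ℝ, ← Real.exp_add, neg_add_cancel, Real.exp_zero] at h
  have e : poissonPMF lam = fun k ↦ Real.exp (-lam) * (lam ^ k / k.factorial) :=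
    funext fun k ↦ mul_div_assoc _ _ _
  rw [e]
  exact h

lemma one_sub_sum_poissonPMF_le {lam : ℝ} (h : 0 ≤ lam) (K : ℕ) :
    1 - ∑ k ∈ range K, poissonPMF lam k ≤ lam ^ K / K.factorial := by
  have h1 := exp_sub_sum_le h K
  have h2 : 1 - ∑ k ∈ range K, poissonPMF lam k =
      Real.exp (-lam) * (Real.exp lam - ∑ m ∈ range K, lam ^ m / (m.factorial : ℝ)) := by
    rw [mul_sub, ← Real.exp_add, neg_add_cancel, Real.exp_zero, mul_sum]
    simp_rw [poissonPMF, mul_div_assoc]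
  rw [h2]
  calc _ ≤ Real.exp (-lam) * (lam ^ K / K.factorial * Real.exp lam) := by gcongr
    _ = lam ^ K / K.factorial * (Real.exp (-lam) * Real.exp lam) := by ring
    _ = _ := by rw [← Real.exp_add, neg_add_cancel, Real.exp_zero, mul_one]

lemma tsum_abs_sub_le {p q : ℕ → ℝ} (hp : HasSum p 1) (hq : HasSum q 1) (hp0 : ∀ k, 0 ≤ p k)
    (hq0 : ∀ k, 0 ≤ q k) (K : ℕ) :
    ∑' k, |p k - q k| ≤
      2 * ∑ k ∈ range K, |p k - q k| + 2 * (1 - ∑ k ∈ range K, q k) := by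
  have hle : ∀ k, |p k - q k| ≤ p k + q k := fun k ↦ by
    rw [abs_le]; constructor <;> linarith [hp0 k, hq0 k]
  have hs : Summable fun k ↦ |p k - q k| :=
    Summable.of_nonneg_of_le (fun k ↦ abs_nonneg _) hle (hp.summable.add hq.summable)
  have hp' := (summable_nat_add_iff K).2 hp.summable
  have hq' := (summable_nat_add_iff K).2 hq.summable
  have h1 : ∑' k, |p (k + K) - q (k + K)| ≤ ∑' k, p (k + K) + ∑' k, q (k + K) := by
    rw [← hp'.tsum_add hq']
    exact ((summable_nat_add_iff K).2 hs).tsum_le_tsum (fun k ↦ hle _) (hp'.add hq')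
  have h2 := hp.summable.sum_add_tsum_nat_add K
  have h3 := hq.summable.sum_add_tsum_nat_add K
  rw [hp.tsum_eq] at h2
  rw [hq.tsum_eq] at h3
  have h4 : ∑ k ∈ range K, q k - ∑ k ∈ range K, p k ≤ ∑ k ∈ range K, |p k - q k| := by
    rw [← sum_sub_distrib]
    refine sum_le_sum fun k _ ↦ ?_
    rw [abs_sub_comm]
    exact le_abs_self _
  rw [← hs.sum_add_tsum_nat_add K]
  linarith

/-- Truncated inclusion-exclusion for the indicator of `x = k`. -/
lemma abs_ite_sub_sum_choose_le (x k J : ℕ) :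
    |(if x = k then 1 else 0 : ℝ) -
      ∑ j ∈ range (J + 1), (-1) ^ j * ((k + j).choose k : ℝ) * (x.choose (k + j) : ℝ)| ≤
      ((k + (J + 1)).choose k : ℝ) * (x.choose (k + (J + 1)) : ℝ) := by
  have hmul : ∀ j, ((k + j).choose k : ℝ) * (x.choose (k + j) : ℝ) =
      x.choose k * (x - k).choose j := fun j ↦ by
    have := Nat.choose_mul (n := x) (Nat.le_add_right k j)
    rw [Nat.add_sub_cancel_left] at this
    rw [mul_comm]
    exact_mod_cast this
  simp_rw [mul_assoc, hmul, mul_left_comm _ (x.choose k : ℝ), ← mul_sum]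
  rcases lt_trichotomy x k with h | rfl | h
  · simp [h.ne, Nat.choose_eq_zero_of_lt h]
  · rw [sum_range_succ']
    simp
  · obtain ⟨m, rfl⟩ : ∃ m, x = k + (m + 1) := ⟨x - k - 1, by omega⟩
    have h1 : ∑ j ∈ range (J + 1), (-1 : ℝ) ^ j * ((k + (m + 1) - k).choose j : ℝ) =
        (-1) ^ J * (m.choose J : ℝ) := by
      rw [Nat.add_sub_cancel_left]
      exact_mod_cast Int.alternating_sum_range_choose_eq_choose (n := m) (m := J)
    rw [h1, Nat.add_sub_cancel_left, if_neg (by omega), zero_sub, abs_neg, abs_mul, abs_mul,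
      abs_pow, abs_neg, abs_one, one_pow, one_mul, Nat.abs_cast, Nat.abs_cast]
    gcongr
    rw [Nat.choose_succ_succ]
    exact Nat.le_add_right _ _

lemma choose_mul_pow_div_factorial (lam : ℝ) (k j : ℕ) :
    ((k + j).choose k : ℝ) * (lam ^ (k + j) / (k + j).factorial) =
      lam ^ k / k.factorial * (lam ^ j / j.factorial) := by
  rw [Nat.cast_add_choose]
  have := Nat.cast_ne_zero (R := ℝ).2 (k + j).factorial_ne_zero
  field_simp
  ring

/-- A distribution whose binomial moments are close to those of a Poisson distribution is close
to this Poisson distribution pointwise. -/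
lemma abs_sub_poissonPMF_le {ι : Type*} {Ω : Finset ι} (hΩ : Ω.Nonempty) (X : ι → ℕ)
    {lam L η : ℝ} (hlam : 0 ≤ lam) (hL : lam ≤ L) {k J : ℕ}
    (hmom : ∀ r ≤ k + (J + 1),
      |(∑ x ∈ Ω, ((X x).choose r : ℝ)) / #Ω - lam ^ r / r.factorial| ≤ η) :
    |(#{x ∈ Ω | X x = k} : ℝ) / #Ω - poissonPMF lam k| ≤
      (1 + Real.exp L) * (L ^ k / k.factorial) * (L ^ (J + 1) / (J + 1).factorial) +
        η * ∑ j ∈ range (J + 2), ((k + j).choose k : ℝ) := by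
  have hΩ' : (0 : ℝ) < #Ω := by exact_mod_cast hΩ.card_pos
  set f : ℕ → ℝ := fun r ↦ (∑ x ∈ Ω, ((X x).choose r : ℝ)) / #Ω with hf
  set m : ℕ → ℝ := fun r ↦ lam ^ r / r.factorial with hm
  have h1 : |(#{x ∈ Ω | X x = k} : ℝ) / #Ω -
      ∑ j ∈ range (J + 1), (-1) ^ j * ((k + j).choose k : ℝ) * f (k + j)| ≤
      ((k + (J + 1)).choose k : ℝ) * f (k + (J + 1)) := by
    have e1 : (#{x ∈ Ω | X x = k} : ℝ) / #Ω -
        ∑ j ∈ range (J + 1), (-1) ^ j * ((k + j).choose k : ℝ) * f (k + j) =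
        (∑ x ∈ Ω, ((if X x = k then 1 else 0 : ℝ) - ∑ j ∈ range (J + 1),
          (-1) ^ j * ((k + j).choose k : ℝ) * ((X x).choose (k + j) : ℝ))) / #Ω := by
      rw [sum_sub_distrib, sum_comm, sub_div, sum_boole, sum_div]
      congr 1
      refine sum_congr rfl fun j _ ↦ ?_
      rw [hf, ← mul_sum, mul_div_assoc]
    rw [e1, abs_div, Nat.abs_cast, hf, ← mul_div_assoc, mul_sum]
    gcongr
    refine (abs_sum_le_sum_abs _ _).trans (sum_le_sum fun x _ ↦ ?_)
    exact abs_ite_sub_sum_choose_le _ _ _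
  have h2 : |∑ j ∈ range (J + 1), (-1) ^ j * ((k + j).choose k : ℝ) * f (k + j) -
      ∑ j ∈ range (J + 1), (-1) ^ j * ((k + j).choose k : ℝ) * m (k + j)| ≤
      η * ∑ j ∈ range (J + 1), ((k + j).choose k : ℝ) := by
    rw [← sum_sub_distrib, mul_sum]
    refine (abs_sum_le_sum_abs _ _).trans (sum_le_sum fun j hj ↦ ?_)
    rw [← mul_sub, abs_mul, abs_mul, abs_pow, abs_neg, abs_one, one_pow, one_mul, Nat.abs_cast,
      mul_comm]
    gcongr
    exact hmom _ (by have := mem_range.1 hj; omega)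
  have h3 : |∑ j ∈ range (J + 1), (-1) ^ j * ((k + j).choose k : ℝ) * m (k + j) -
      poissonPMF lam k| ≤ m k * (m (J + 1) * Real.exp lam) := by
    have e1 : ∑ j ∈ range (J + 1), (-1) ^ j * ((k + j).choose k : ℝ) * m (k + j) =
        m k * ∑ j ∈ range (J + 1), (-lam) ^ j / (j.factorial : ℝ) := by
      rw [mul_sum]
      refine sum_congr rfl fun j _ ↦ ?_
      rw [mul_assoc, hm, choose_mul_pow_div_factorial, neg_pow lam j]
      ring
    have e2 : poissonPMF lam k = m k * Real.exp (-lam) := by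
      rw [poissonPMF, hm]; ring
    rw [e1, e2, ← mul_sub, abs_mul, abs_of_nonneg (by positivity : 0 ≤ m k), abs_sub_comm]
    gcongr
    have := abs_exp_sub_sum_le (-lam) (J + 1)
    rwa [abs_neg, abs_of_nonneg hlam] at this
  have h4 : ((k + (J + 1)).choose k : ℝ) * f (k + (J + 1)) ≤
      m k * m (J + 1) + η * ((k + (J + 1)).choose k : ℝ) := by
    have e1 := (abs_le.1 (hmom (k + (J + 1)) le_rfl)).2
    rw [hm, ← choose_mul_pow_div_factorial, mul_comm η, ← mul_add]
    gcongr
    linarith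
  have h5 : m k * m (J + 1) * (1 + Real.exp lam) ≤
      (1 + Real.exp L) * (L ^ k / k.factorial) * (L ^ (J + 1) / (J + 1).factorial) := by
    have hm0 (r) : 0 ≤ m r := by simp only [hm]; positivity
    have hmL (r) : m r ≤ L ^ r / r.factorial := by simp only [hm]; gcongr
    rw [mul_comm, mul_assoc]
    have hk := hmL k
    have hJ := hmL (J + 1)
    have := hm0 k
    have := hm0 (J + 1)
    have := hlam.trans hL
    gcongr
  rw [sum_range_succ _ (J + 1)]
  rw [abs_le] at h1 h2 h3 ⊢
  constructor <;> linarith [h1.1, h1.2, h2.1, h2.2, h3.1, h3.2]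

/-- Quantitative method of moments for the Poisson distribution. -/
lemma exists_forall_tsum_abs_sub_poissonPMF_le {L ε : ℝ} (hL : 0 ≤ L) (hε : 0 < ε) :
    ∃ (R : ℕ) (η : ℝ), 0 < η ∧ ∀ {ι : Type} (Ω : Finset ι), Ω.Nonempty → ∀ (X : ι → ℕ) (lam : ℝ),
      0 ≤ lam → lam ≤ L →
      (∀ r ≤ R, |(∑ x ∈ Ω, ((X x).choose r : ℝ)) / #Ω - lam ^ r / r.factorial| ≤ η) →
      1 / 2 * ∑' k, |(#{x ∈ Ω | X x = k} : ℝ) / #Ω - poissonPMF lam k| ≤ ε := by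
  have hlim := FloorSemiring.tendsto_pow_div_factorial_atTop L
  obtain ⟨K, hK⟩ := (hlim.eventually_lt_const (show 0 < ε / 2 by positivity)).exists
  set A := ∑ k ∈ range K, (1 + Real.exp L) * (L ^ k / (k.factorial : ℝ)) with hA
  have hA0 : 0 ≤ A := by positivity
  obtain ⟨J, hJ⟩ := ((Filter.tendsto_add_atTop_iff_nat 1).2 hlim).eventually_lt_const
    (show 0 < ε / (4 * (A + 1)) by positivity) |>.exists
  set B := ∑ k ∈ range K, ∑ j ∈ range (J + 2), ((k + j).choose k : ℝ) with hB
  have hB0 : 0 ≤ B := by positivity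
  refine ⟨K + (J + 1), ε / (4 * (B + 1)), by positivity, fun {ι} Ω hΩ X lam hlam hlamL hmom ↦ ?_⟩
  have hΩ' : (0 : ℝ) < #Ω := by exact_mod_cast hΩ.card_pos
  have hp : HasSum (fun k ↦ (#{x ∈ Ω | X x = k} : ℝ) / #Ω) 1 := by
    have h1 : ∑ k ∈ Ω.image X, (#{x ∈ Ω | X x = k} : ℝ) / #Ω = 1 := by
      rw [← sum_div, div_eq_one_iff_eq hΩ'.ne']
      exact_mod_cast (card_eq_sum_card_image X Ω).symm
    rw [← h1]
    refine hasSum_sum_of_ne_finset_zero fun k hk ↦ ?_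
    have : ({x ∈ Ω | X x = k} : Finset ι) = ∅ :=
      filter_eq_empty_iff.2 fun x hx hxk ↦ hk (mem_image.2 ⟨x, hx, hxk⟩)
    simp [this]
  have h1 := tsum_abs_sub_le hp (hasSum_poissonPMF lam) (fun k ↦ by positivity)
    (fun k ↦ by unfold poissonPMF; positivity) K
  have h2 : 1 - ∑ k ∈ range K, poissonPMF lam k ≤ ε / 2 :=
    (one_sub_sum_poissonPMF_le hlam K).trans (le_trans (by gcongr) hK.le)
  have h3 : ∑ k ∈ range K, |(#{x ∈ Ω | X x = k} : ℝ) / #Ω - poissonPMF lam k| ≤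
      A * (ε / (4 * (A + 1))) + ε / (4 * (B + 1)) * B := by
    rw [hA, hB, sum_mul, mul_sum, ← sum_add_distrib]
    refine sum_le_sum fun k hk ↦ ?_
    refine (abs_sub_poissonPMF_le hΩ X hlam hlamL (J := J) fun r hr ↦ hmom r ?_).trans ?_
    · have := mem_range.1 hk
      omega
    · gcongr
  have h4 : A * (ε / (4 * (A + 1))) ≤ ε / 4 := by
    rw [← mul_div_assoc, div_le_iff₀ (by positivity)]
    nlinarith
  have h5 : ε / (4 * (B + 1)) * B ≤ ε / 4 := by
    rw [div_mul_eq_mul_div, div_le_iff₀ (by positivity)]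
    nlinarith
  linarith

end PoissonConvergence

section Correspondence

variable {V : Type*}

lemma IsMatchingIn.exists_partner {G : SimpleGraph V} {N : Finset (Sym2 V)}
    (hN : IsMatchingIn G N) : ∃ π : V → V, ∀ e ∈ N, ∀ v ∈ e, e = s(v, π v) := by
  have h (v : V) : ∃ w, ∀ e ∈ N, v ∈ e → e = s(v, w) := by
    by_cases hv : ∃ e ∈ N, v ∈ e
    · obtain ⟨e, he, hve⟩ := hv
      obtain ⟨w, hw⟩ := Sym2.mem_iff_exists.1 hve
      refine ⟨w, fun f hf hvf ↦ ?_⟩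
      rw [← hw]
      by_contra hne
      exact hN.2 f hf e he hne v hvf hve
    · push Not at hv
      exact ⟨v, fun e he hve ↦ absurd hve (hv e he)⟩
  choose π hπ using h
  exact ⟨π, fun e he v hv ↦ hπ v e he hv⟩

variable [Fintype V] [DecidableEq V]

/-- The vertices incident to an edge of `R`. -/
def covered (R : Finset (Sym2 V)) : Finset V := {v | ∃ e ∈ R, v ∈ e}

/-- The edges `s(v, σ v)` of an involution `σ`. -/
def edgesOf (σ : Equiv.Perm V) : Finset (Sym2 V) := univ.image fun v ↦ s(v, σ v)

lemma mem_covered {R : Finset (Sym2 V)} {v : V} : v ∈ covered R ↔ ∃ e ∈ R, v ∈ e := by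
  simp [covered]

lemma covered_insert (R : Finset (Sym2 V)) (u w : V) :
    covered (insert s(u, w) R) = insert u (insert w (covered R)) := by
  ext v
  simp [mem_covered, or_assoc]

lemma mk_mem_edgesOf {σ : Equiv.Perm V} (hσ : ∀ v, σ (σ v) = v) {u w : V} :
    s(u, w) ∈ edgesOf σ ↔ σ u = w := by
  simp only [edgesOf, mem_image, mem_univ, true_and, Sym2.eq_iff]
  constructor
  · rintro ⟨v, ⟨rfl, h⟩ | ⟨rfl, rfl⟩⟩
    exacts [h, hσ _]
  · exact fun h ↦ ⟨u, .inl ⟨rfl, h⟩⟩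

lemma subset_edgesOf_iff {σ : Equiv.Perm V} (hσ : ∀ v, σ (σ v) = v) {π : V → V}
    {R : Finset (Sym2 V)} (hπ : ∀ e ∈ R, ∀ v ∈ e, e = s(v, π v)) :
    R ⊆ edgesOf σ ↔ ∀ v ∈ covered R, σ v = π v := by
  constructor
  · intro h v hv
    obtain ⟨e, he, hve⟩ := mem_covered.1 hv
    rw [← mk_mem_edgesOf hσ, ← hπ e he v hve]
    exact h he
  · intro h e he
    have hv := Sym2.out_fst_mem e
    rw [hπ e he _ hv, mk_mem_edgesOf hσ]
    exact h _ (mem_covered.2 ⟨e, he, hv⟩)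

variable {G : SimpleGraph V} [DecidableRel G.Adj]

lemma filter_subset_edgesOf {π : V → V} {R : Finset (Sym2 V)}
    (hπ : ∀ e ∈ R, ∀ v ∈ e, e = s(v, π v)) :
    {σ ∈ matchings G ∅ π | R ⊆ edgesOf σ} = matchings G (covered R) π := by
  ext σ
  rw [mem_filter, mem_matchings, mem_matchings]
  constructor
  · rintro ⟨⟨h1, h2, -⟩, h⟩
    exact ⟨h1, h2, (subset_edgesOf_iff h1 hπ).1 h⟩
  · rintro ⟨h1, h2, h⟩
    exact ⟨⟨h1, h2, by simp⟩, (subset_edgesOf_iff h1 hπ).2 h⟩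

lemma isPM_edgesOf {π : V → V} {σ : Equiv.Perm V} (hσ : σ ∈ matchings G ∅ π) :
    IsPM G (edgesOf σ) := by
  obtain ⟨h1, h2, -⟩ := mem_matchings.1 hσ
  refine ⟨fun e he ↦ ?_, fun v ↦ ⟨s(v, σ v), ⟨(mk_mem_edgesOf h1).2 rfl, Sym2.mem_mk_left _ _⟩, ?_⟩⟩
  · obtain ⟨v, -, rfl⟩ := mem_image.1 he
    exact h2 v
  · rintro e ⟨he, hve⟩
    obtain ⟨w, rfl⟩ := Sym2.mem_iff_exists.1 hve
    rw [(mk_mem_edgesOf h1).1 he]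

lemma IsPM.exists_edgesOf_eq {M : Finset (Sym2 V)} (hM : IsPM G M) (π : V → V) :
    ∃ σ ∈ matchings G ∅ π, edgesOf σ = M := by
  have h (v : V) : ∃ w, ∀ x, s(v, x) ∈ M ↔ x = w := by
    obtain ⟨e, ⟨he, hve⟩, huniq⟩ := hM.2 v
    obtain ⟨w, rfl⟩ := Sym2.mem_iff_exists.1 hve
    refine ⟨w, fun x ↦ ⟨fun hx ↦ ?_, fun hx ↦ hx ▸ he⟩⟩
    exact Sym2.congr_right.1 (huniq _ ⟨hx, Sym2.mem_mk_left _ _⟩)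
  choose g hg using h
  have hinv : Function.Involutive g := fun v ↦ by
    rw [eq_comm, ← hg, Sym2.eq_swap, hg]
  have hσ : hinv.toPerm g ∈ matchings G ∅ π :=
    mem_matchings.2 ⟨hinv, fun v ↦ hM.1 _ ((hg v _).2 rfl), by simp⟩
  refine ⟨_, hσ, ?_⟩
  ext e
  induction e with
  | _ u w =>
    rw [mk_mem_edgesOf (mem_matchings.1 hσ).1, hg, eq_comm]
    rfl

lemma natCard_isPM (π : V → V) (P : Finset (Sym2 V) → Prop) [DecidablePred P] :
    Nat.card {M : Finset (Sym2 V) // IsPM G M ∧ P M} =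
      #{σ ∈ matchings G ∅ π | P (edgesOf σ)} := by
  have hmem (σ : {σ ∈ matchings G ∅ π | P (edgesOf σ)}) := mem_filter.1 σ.2
  rw [← Fintype.card_coe, ← Nat.card_eq_fintype_card]
  refine (Nat.card_eq_of_bijective (fun σ : {σ ∈ matchings G ∅ π | P (edgesOf σ)} ↦
    ⟨edgesOf σ.1, isPM_edgesOf (hmem σ).1, (hmem σ).2⟩) ⟨fun σ ρ h ↦ ?_, ?_⟩).symm
  · refine Subtype.ext (Equiv.ext fun v ↦ ?_)
    have hv := (mk_mem_edgesOf (mem_matchings.1 (hmem ρ).1).1 (u := v) (w := ρ.1 v)).2 rfl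
    have hσρ : edgesOf σ.1 = edgesOf ρ.1 := Subtype.ext_iff.1 h
    rw [← hσρ] at hv
    exact (mk_mem_edgesOf (mem_matchings.1 (hmem σ).1).1).1 hv
  · rintro ⟨M, hM, hPM⟩
    obtain ⟨σ, hσ, rfl⟩ := hM.exists_edgesOf_eq π
    exact ⟨⟨σ, mem_filter.2 ⟨hσ, hPM⟩⟩, rfl⟩

lemma sum_choose_card_inter {π : V → V} {N : Finset (Sym2 V)}
    (hπ : ∀ e ∈ N, ∀ v ∈ e, e = s(v, π v)) (r : ℕ) :
    ∑ σ ∈ matchings G ∅ π, (#(edgesOf σ ∩ N)).choose r =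
      ∑ R ∈ powersetCard r N, #(matchings G (covered R) π) := by
  have h (σ : Equiv.Perm V) : (#(edgesOf σ ∩ N)).choose r =
      ∑ R ∈ powersetCard r N, if R ⊆ edgesOf σ then 1 else 0 := by
    rw [← card_powersetCard, ← card_filter]
    congr 1
    ext R
    simp only [mem_powersetCard, mem_filter, subset_inter_iff]
    tauto
  simp_rw [h]
  rw [sum_comm]
  refine sum_congr rfl fun R hR ↦ ?_
  rw [← card_filter, filter_subset_edgesOf]
  exact fun e he ↦ hπ e ((mem_powersetCard.1 hR).1 he)

lemma abs_pow_mul_card_matchings_covered_sub_le {π : V → V} {N : Finset (Sym2 V)}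
    (hN : IsMatchingIn G N) (hπ : ∀ e ∈ N, ∀ v ∈ e, e = s(v, π v)) {d K : ℕ} {η : ℝ} (hη : 0 ≤ η)
    (hstep : ∀ F u, #F ≤ 2 * K → (∀ v ∈ F, π v ∈ F) → u ∉ F → G.Adj u (π u) → π (π u) = u →
      |(d : ℝ) * #(matchings G (insert u (insert (π u) F)) π) - #(matchings G F π)| ≤
        η * #(matchings G F π)) {R : Finset (Sym2 V)} (hRN : R ⊆ N) (hRK : #R ≤ K) :
    |(d : ℝ) ^ #R * #(matchings G (covered R) π) - #(matchings G ∅ π)| ≤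
      ((1 + η) ^ #R - 1) * #(matchings G ∅ π) ∧ #(covered R) ≤ 2 * #R := by
  induction R using Finset.induction_on with
  | empty => simp [covered]
  | insert e R he ih =>
    rw [card_insert_of_notMem he] at hRK ⊢
    rw [insert_subset_iff] at hRN
    obtain ⟨ih, hcard⟩ := ih hRN.2 (by omega)
    have hu := Sym2.out_fst_mem e
    set u := e.out.1
    have heu := hπ e hRN.1 u hu
    have hadj : G.Adj u (π u) := hN.1 s(u, π u) (heu ▸ hRN.1)
    have hππ : π (π u) = u := by
      have h := hπ e hRN.1 (π u) (heu ▸ Sym2.mem_mk_right _ _)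
      rw [heu, Sym2.eq_swap] at h
      exact (Sym2.congr_right.1 h).symm
    have hclosed : ∀ v ∈ covered R, π v ∈ covered R := fun v hv ↦ by
      obtain ⟨f, hf, hvf⟩ := mem_covered.1 hv
      refine mem_covered.2 ⟨f, hf, ?_⟩
      rw [hπ f (hRN.2 hf) v hvf]
      exact Sym2.mem_mk_right _ _
    have huR : u ∉ covered R := fun h ↦ by
      obtain ⟨f, hf, huf⟩ := mem_covered.1 h
      rw [hπ f (hRN.2 hf) u huf, ← heu] at hf
      exact he hf
    have h := hstep (covered R) u (by omega) hclosed huR hadj hππ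
    rw [heu, covered_insert]
    refine ⟨?_, (card_insert_le _ _).trans (by grw [card_insert_le]; omega)⟩
    set m : ℝ := (#(matchings G (covered R) π) : ℝ)
    set Z : ℝ := (#(matchings G ∅ π) : ℝ)
    have h1 := mul_le_mul_of_nonneg_left h (by positivity : (0 : ℝ) ≤ d ^ #R)
    rw [← abs_of_nonneg (by positivity : (0 : ℝ) ≤ d ^ #R), ← abs_mul,
      abs_of_nonneg (by positivity : (0 : ℝ) ≤ d ^ #R)] at h1
    have h2 := (abs_le.1 ih).2
    have h3 := mul_le_mul_of_nonneg_left h2 hη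
    calc _ = |(d : ℝ) ^ #R * (d * #(matchings G (insert u (insert (π u) (covered R))) π) - m) +
          (d ^ #R * m - Z)| := by congr 1; ring
      _ ≤ _ := abs_add_le _ _
      _ ≤ d ^ #R * (η * m) + ((1 + η) ^ #R - 1) * Z := add_le_add h1 ih
      _ ≤ _ := by rw [pow_succ]; linarith

lemma abs_pow_mul_sum_choose_sub_le {N : Finset (Sym2 V)} {π : V → V}
    (hN : IsMatchingIn G N) (hπ : ∀ e ∈ N, ∀ v ∈ e, e = s(v, π v)) {d K : ℕ} {η : ℝ} (hη : 0 ≤ η)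
    (hstep : ∀ F u, #F ≤ 2 * K → (∀ v ∈ F, π v ∈ F) → u ∉ F → G.Adj u (π u) → π (π u) = u →
      |(d : ℝ) * #(matchings G (insert u (insert (π u) F)) π) - #(matchings G F π)| ≤
        η * #(matchings G F π)) {r : ℕ} (hr : r ≤ K) :
    |(d : ℝ) ^ r * ∑ σ ∈ matchings G ∅ π, ((#(edgesOf σ ∩ N)).choose r : ℝ) -
      (#N).choose r * #(matchings G ∅ π)| ≤
      (#N).choose r * (((1 + η) ^ r - 1) * #(matchings G ∅ π)) := by
  rw [← Nat.cast_sum, sum_choose_card_inter hπ, ← card_powersetCard, ← nsmul_eq_mul,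
    ← nsmul_eq_mul, ← sum_const, ← sum_const, Nat.cast_sum, mul_sum, ← sum_sub_distrib]
  refine (abs_sum_le_sum_abs _ _).trans (sum_le_sum fun R hR ↦ ?_)
  obtain ⟨hRN, rfl⟩ := mem_powersetCard.1 hR
  exact (abs_pow_mul_card_matchings_covered_sub_le hN hπ hη hstep hRN hr).1

end Correspondence

section Assembly

lemma abs_descFactorial_div_sub_pow_le {m d : ℕ} {L : ℝ} (hd : 0 < d) (hL : 1 ≤ L)
    (hm : (m : ℝ) / d ≤ L) (r : ℕ) :
    |(m.descFactorial r : ℝ) / d ^ r - ((m : ℝ) / d) ^ r| ≤ r ^ 2 * L ^ r / d := by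
  have hd' : (0 : ℝ) < d := by exact_mod_cast hd
  induction r with
  | zero => simp
  | succ r ih =>
    have hle : (m.descFactorial r : ℝ) / d ^ r ≤ L ^ r := by
      calc (m.descFactorial r : ℝ) / d ^ r ≤ (m : ℝ) ^ r / d ^ r := by
            gcongr
            exact_mod_cast m.descFactorial_le_pow r
        _ = ((m : ℝ) / d) ^ r := (div_pow _ _ _).symm
        _ ≤ L ^ r := by gcongr
    have hrec : (m.descFactorial (r + 1) : ℝ) / d ^ (r + 1) =
        ((m : ℝ) / d - r / d) * ((m.descFactorial r : ℝ) / d ^ r) := by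
      have h : (m.descFactorial (r + 1) : ℝ) = (m - r) * m.descFactorial r := by
        rw [Nat.descFactorial_succ, Nat.cast_mul]
        rcases le_or_gt r m with h | h
        · rw [Nat.cast_sub h]
        · simp [Nat.descFactorial_eq_zero_iff_lt.2 h]
      rw [h, pow_succ]
      field_simp
    set a : ℝ := (m.descFactorial r : ℝ) / d ^ r with ha
    have ha0 : 0 ≤ a := by positivity
    rw [hrec]
    calc _ = |(m : ℝ) / d * (a - ((m : ℝ) / d) ^ r) + -(r / d * a)| := by congr 1; ring
      _ ≤ (m : ℝ) / d * |a - ((m : ℝ) / d) ^ r| + r / d * a := by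
        refine (abs_add_le _ _).trans (le_of_eq ?_)
        rw [abs_neg, abs_mul, abs_of_nonneg (by positivity : 0 ≤ (m : ℝ) / d),
          abs_of_nonneg (by positivity : 0 ≤ r / d * a)]
      _ ≤ L * (r ^ 2 * L ^ r / d) + r / d * (L * L ^ r) := by
        gcongr
        exact hle.trans (le_mul_of_one_le_left (by positivity) hL)
      _ = (r ^ 2 + r) * L ^ (r + 1) / d := by rw [pow_succ]; ring
      _ ≤ _ := by
        push_cast
        gcongr
        nlinarith

lemma abs_div_sub_pow_div_factorial_le {m d r K : ℕ} {L η S Z : ℝ} (hd : 0 < d) (hL : 1 ≤ L)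
    (hη : 0 ≤ η) (hZ : 0 < Z) (hm : (m : ℝ) / d ≤ L) (hr : r ≤ K)
    (h : |(d : ℝ) ^ r * S - m.choose r * Z| ≤ m.choose r * (((1 + η) ^ r - 1) * Z)) :
    |S / Z - ((m : ℝ) / d) ^ r / r.factorial| ≤ L ^ K * ((1 + η) ^ K - 1) + K ^ 2 * L ^ K / d := by
  have hd' : (0 : ℝ) < d := by exact_mod_cast hd
  have hdr : (0 : ℝ) < d ^ r := by positivity
  have hf : (1 : ℝ) ≤ r.factorial := by exact_mod_cast r.factorial_pos
  have hpow : (1 : ℝ) ≤ (1 + η) ^ r := one_le_pow₀ (by linarith)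
  have hLr : L ^ r ≤ L ^ K := pow_le_pow_right₀ hL hr
  have hchoose : (m.choose r : ℝ) / d ^ r ≤ L ^ r := by
    calc (m.choose r : ℝ) / d ^ r ≤ (m : ℝ) ^ r / d ^ r := by
          gcongr
          exact_mod_cast Nat.choose_le_pow m r
      _ = ((m : ℝ) / d) ^ r := (div_pow _ _ _).symm
      _ ≤ L ^ r := by gcongr
  have h1 : |S / Z - (m.choose r : ℝ) / d ^ r| ≤ L ^ K * ((1 + η) ^ K - 1) := by
    have e : S / Z - (m.choose r : ℝ) / d ^ r =
        ((d : ℝ) ^ r * S - m.choose r * Z) / (d ^ r * Z) := by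
      field_simp
    rw [e, abs_div, abs_of_pos (by positivity : 0 < (d : ℝ) ^ r * Z)]
    calc _ ≤ m.choose r * (((1 + η) ^ r - 1) * Z) / (d ^ r * Z) := by gcongr
      _ = (m.choose r : ℝ) / d ^ r * ((1 + η) ^ r - 1) := by field_simp
      _ ≤ _ := by
        have := hchoose.trans hLr
        have : (1 : ℝ) + η ≥ 1 := by linarith
        gcongr
  have h2 : |(m.choose r : ℝ) / d ^ r - ((m : ℝ) / d) ^ r / r.factorial| ≤ K ^ 2 * L ^ K / d := by
    have e : (m.choose r : ℝ) / d ^ r - ((m : ℝ) / d) ^ r / r.factorial =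
        ((m.descFactorial r : ℝ) / d ^ r - ((m : ℝ) / d) ^ r) / r.factorial := by
      rw [Nat.descFactorial_eq_factorial_mul_choose]
      push_cast
      field_simp
    rw [e, abs_div, Nat.abs_cast]
    calc _ ≤ |(m.descFactorial r : ℝ) / d ^ r - ((m : ℝ) / d) ^ r| :=
          div_le_self (abs_nonneg _) hf
      _ ≤ _ := abs_descFactorial_div_sub_pow_le hd hL hm r
      _ ≤ _ := by gcongr
  exact (abs_sub_le _ _ _).trans (add_le_add h1 h2)

lemma exists_pow_mul_one_add_pow_sub_one_le (L : ℝ) (K : ℕ) {ε : ℝ} (hε : 0 < ε) :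
    ∃ η : ℝ, 0 < η ∧ η ≤ 1 ∧ L ^ K * ((1 + η) ^ K - 1) ≤ ε := by
  have hlim : Filter.Tendsto (fun η : ℝ ↦ L ^ K * ((1 + η) ^ K - 1)) (nhdsWithin 0 (Set.Ioi 0))
      (nhds 0) := by
    have h : Continuous fun η : ℝ ↦ L ^ K * ((1 + η) ^ K - 1) := by fun_prop
    exact (h.tendsto' 0 0 (by simp)).mono_left nhdsWithin_le_nhds
  obtain ⟨η, h1, h2⟩ := ((hlim.eventually_lt_const hε).and
    (Ioc_mem_nhdsGT (zero_lt_one (α := ℝ)))).exists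
  exact ⟨η, h2.1, h2.2, h1.le⟩

variable {V : Type*} [Fintype V] {G : SimpleGraph V}

lemma IsMatchingIn.card_le {N : Finset (Sym2 V)} (hN : IsMatchingIn G N) :
    #N ≤ Fintype.card V := by
  refine card_le_card_of_injOn (fun e ↦ e.out.1) (fun _ _ ↦ mem_univ _) fun e he f hf hef ↦ ?_
  by_contra hne
  refine hN.2 e he f hf hne _ (Sym2.out_fst_mem e) ?_
  rw [show e.out.1 = f.out.1 from hef]
  exact Sym2.out_fst_mem f

variable [DecidableRel G.Adj]

lemma RegularDeg.isRegularOfDegree {d : ℕ} (h : RegularDeg G d) : G.IsRegularOfDegree d := by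
  intro v
  rw [← h v, ← SimpleGraph.card_neighborSet_eq_degree, ← Nat.card_eq_fintype_card]
  rfl

variable [DecidableEq V]

lemma RobustExpander.largeSetsExpand {δ κ ν τ : ℝ} {d : ℕ} (h : RobustExpander G ν τ)
    (hreg : G.IsRegularOfDegree d) (hd : δ * Fintype.card V ≤ d) (hτ : τ ≤ δ / 2)
    (hτ' : τ ≤ 1 / 2) (hκ0 : 0 ≤ κ) (hκ : κ ≤ ν) (hκ' : κ ≤ 1 / 2) : LargeSetsExpand G d κ ν := by
  intro S hS
  have hn : (0 : ℝ) ≤ Fintype.card V := by positivity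
  have hcard (T : Finset V) : (Nat.card (T : Set V) : ℝ) = #T := by simp
  rcases le_or_gt (#S : ℝ) ((1 - τ) * Fintype.card V) with hS' | hS'
  · refine (min_le_right _ _).trans ?_
    have hτn := mul_le_mul_of_nonneg_right hτ' hn
    have h1 := h S (by rw [hcard]; linarith) (by rwa [hcard])
    rw [hcard] at h1
    refine h1.trans ?_
    rw [← hcard]
    have hsub : RN G ν S ⊆
        ({x | κ * d ≤ (#(G.neighborFinset x ∩ S) : ℝ)} : Finset V) := by
      intro v hv
      have hset : {u : V | u ∈ (S : Set V) ∧ G.Adj v u} =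
          ((G.neighborFinset v ∩ S : Finset V) : Set V) := by
        ext u; simp [and_comm]
      rw [RN, Set.mem_ofPred_eq, hset, hcard] at hv
      rw [mem_coe, mem_filter]
      refine ⟨mem_univ _, le_trans ?_ hv⟩
      have hdn : (d : ℝ) ≤ Fintype.card V := by
        rw [← hreg v]
        exact_mod_cast (G.degree_lt_card_verts v).le
      gcongr
      exact hκ0.trans hκ
    exact_mod_cast Nat.card_mono (Set.toFinite _) hsub
  · refine (min_le_left _ _).trans ?_
    rw [filter_true_of_mem, card_univ]
    intro x _
    have h1 : #(G.neighborFinset x) ≤ #(G.neighborFinset x ∩ S) + #Sᶜ := by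
      rw [← card_inter_add_card_sdiff (G.neighborFinset x) S]
      gcongr
      exact fun v hv ↦ mem_compl.2 (mem_sdiff.1 hv).2
    have h2 := card_add_card_compl S
    rw [G.card_neighborFinset_eq_degree, hreg x] at h1
    have h1' : (d : ℝ) ≤ #(G.neighborFinset x ∩ S) + #Sᶜ := by exact_mod_cast h1
    have h2' : (#S : ℝ) + #Sᶜ = Fintype.card V := by exact_mod_cast h2
    have h3 : τ * Fintype.card V ≤ δ / 2 * Fintype.card V := by gcongr
    have h4 : κ * d ≤ 1 / 2 * d := by gcongr
    linarith

lemma interProb_eq (π : V → V) (N : Finset (Sym2 V)) (k : ℕ) :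
    interProb G N k =
      (#{σ ∈ matchings G ∅ π | #(edgesOf σ ∩ N) = k} : ℝ) / #(matchings G ∅ π) := by
  have h := natCard_isPM (G := G) π fun _ ↦ True
  simp only [and_true, filter_true] at h
  rw [interProb, pmCount, natCard_isPM π fun M ↦ #(M ∩ N) = k, h]

end Assembly

/-- For a uniformly random perfect matching `M` of a `d`-regular robust
`(ν,τ)`-expander `G` and a fixed matching `N` in `G`, the number of edges of `N` in `M`
is within total variation distance `ε` of a Poisson distribution with mean `|N|/d`. -/
theorem poisson_approximation_matching :
    ∀ δ : ℝ, 0 < δ →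
    ∃ τ : ℝ, 0 < τ ∧
    ∀ ν : ℝ, 0 < ν →
    ∀ ε : ℝ, 0 < ε →
    ∃ n₀ : ℕ, ∀ n : ℕ, n₀ ≤ n → Even n →
    ∀ d : ℕ, δ * (n : ℝ) ≤ (d : ℝ) →
    ∀ (V : Type) [Fintype V] [DecidableEq V], Fintype.card V = n →
    ∀ G : SimpleGraph V, RegularDeg G d → RobustExpander G ν τ →
    pmCount G ≠ 0 →
    ∀ N : Finset (Sym2 V), IsMatchingIn G N →
      (1 / 2) * ∑' k : ℕ, |interProb G N k - poissonPMF ((N.card : ℝ) / (d : ℝ)) k| ≤ ε := by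
  intro δ hδ
  refine ⟨min (δ / 2) (1 / 2), by positivity, fun ν hν ε hε ↦ ?_⟩
  set L : ℝ := max 1 (1 / δ)
  have hL1 : 1 ≤ L := le_max_left _ _
  obtain ⟨K, θ, hθ, hpoisson⟩ :=
    exists_forall_tsum_abs_sub_poissonPMF_le (zero_le_one.trans hL1) hε
  obtain ⟨η, hη, hη1, hηθ⟩ := exists_pow_mul_one_add_pow_sub_one_le L K (half_pos hθ)
  obtain ⟨n₁, hn₁⟩ := abs_mul_card_matchings_insert_sub_le hδ
    (show 0 < min ν (1 / 2) by positivity) (by linarith [min_le_right ν (1 / 2)]) hν hη hη1 (2 * K)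
  obtain ⟨n₂, hn₂⟩ := exists_nat_ge (K ^ 2 * L ^ K / (δ * (θ / 2)))
  refine ⟨max 1 (max n₁ n₂), ?_⟩
  intro n hn _ d hd V _ _ hVn G hreg hexp hpm N hN
  subst hVn
  classical
  obtain ⟨π, hπ⟩ := hN.exists_partner
  have hreg' := hreg.isRegularOfDegree
  have hlarge : LargeSetsExpand G d (min ν (1 / 2)) ν :=
    hexp.largeSetsExpand hreg' hd (min_le_left _ _) (min_le_right _ _) (by positivity)
      (min_le_left _ _) (min_le_right _ _)
  have hstep := hn₁ V G d (by omega) hd hreg' hlarge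
  have hn0 : (1 : ℝ) ≤ Fintype.card V := by exact_mod_cast (le_max_left _ _).trans hn
  have hd0 : (0 : ℝ) < d := lt_of_lt_of_le (by positivity) hd
  have hlam : (#N : ℝ) / d ≤ L := by
    refine le_trans ?_ (le_max_right _ _)
    rw [div_le_div_iff₀ hd0 hδ]
    have : (#N : ℝ) ≤ Fintype.card V := by exact_mod_cast hN.card_le
    nlinarith
  have herr : K ^ 2 * L ^ K / d ≤ θ / 2 := by
    have h2 : (n₂ : ℝ) ≤ Fintype.card V := by
      exact_mod_cast (le_max_right _ _).trans ((le_max_right _ _).trans hn)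
    have h3 := hn₂.trans h2
    rw [div_le_iff₀ (by positivity)] at h3
    rw [div_le_iff₀ hd0]
    nlinarith
  have hne : (matchings G ∅ π).Nonempty := by
    have h := natCard_isPM (G := G) π fun _ ↦ True
    simp only [and_true, filter_true] at h
    rw [← card_pos, ← h]
    exact Nat.pos_of_ne_zero hpm
  simp_rw [interProb_eq π]
  refine hpoisson _ hne (fun σ ↦ #(edgesOf σ ∩ N)) _ (by positivity) hlam fun r hr ↦ ?_
  refine (abs_div_sub_pow_div_factorial_le (by exact_mod_cast hd0) hL1 hη.le
    (by exact_mod_cast hne.card_pos) hlam hr (abs_pow_mul_sum_choose_sub_le hN hπ hη.le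
      (fun F u ↦ hstep F π u) hr)).trans ?_
  linarith

end RPM
end
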